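/- Suppose f is good with right derivative satisfying f′(x) ≤ 1/(2(x+1)), and suppose the generic structure M_f is MS-measurable with dimension-measure function h = (dim, μ). Then for all finite tuples ā, b̄ in M_f: dim(loc(b̄/ā)) = dim(M_f)·d(b̄/ā), where loc(b̄/ā) is the set of realizations in M_f of the complete type of b̄ over ā (a definable set, by ω-categoricity) and d(b̄/ā) = d^{M_f}(ā ∪ b̄) − d^{M_f}(ā). -/

import Mathlib

open FirstOrder Set

namespace MeasureAmalgamation

variable (L : FirstOrder.Language)

/-- The predimension `δ(A) = |A| − Σ_i |R_i[A]|` of a (finite) subset `A` of an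
`L`-structure: the number of points minus the number of relation instances inside `A`. -/
noncomputable def delta {N : Type*} [L.Structure N] (A : Set N) : ℤ :=
  (A.ncard : ℤ) -
    (Set.ncard {p : Σ n, L.Relations n × (Fin n → N) |
      (∀ i, p.2.2 i ∈ A) ∧ Language.Structure.RelMap p.2.1 p.2.2} : ℤ)

/-- `A ≤ B` (`A` is self-sufficient in `B`): `A ⊆ B` and `δ(A) < δ(B′)` whenever
`A ⊊ B′ ⊆ B` with `B′` finite. -/
def SelfSuffIn {N : Type*} [L.Structure N] (A B : Set N) : Prop :=
  A ⊆ B ∧ ∀ B' : Set N, A ⊂ B' → B' ⊆ B → B'.Finite → delta L A < delta L B'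

/-- `A ≤ M` for the (possibly infinite) ambient structure:
`A ∩ X ≤ X` for every finite `X ⊆ M`. -/
def SelfSuffM {N : Type*} [L.Structure N] (A : Set N) : Prop :=
  ∀ X : Set N, X.Finite → SelfSuffIn L (A ∩ X) X

/-- The closure `cl_B(X)`: the smallest self-sufficient subset of `B` containing `X`. -/
def clIn {N : Type*} [L.Structure N] (X B : Set N) : Set N :=
  ⋂₀ {A : Set N | X ⊆ A ∧ SelfSuffIn L A B}

/-- The dimension `d^B(X) = δ(cl_B(X))`. -/
noncomputable def dIn {N : Type*} [L.Structure N] (X B : Set N) : ℤ :=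
  delta L (clIn L X B)

/-- The closure `cl_M(X)` in the ambient structure. -/
def clM {N : Type*} [L.Structure N] (X : Set N) : Set N :=
  ⋂₀ {A : Set N | X ⊆ A ∧ SelfSuffM L A}

/-- The dimension `d(X) = δ(cl_M(X))` in the ambient structure. -/
noncomputable def dM {N : Type*} [L.Structure N] (X : Set N) : ℤ :=
  delta L (clM L X)

/-- Membership in the class `K_f`: every (finite) subset `X` satisfies
`δ(X) ≥ f(|X|)`. -/
def InKf (f : ℝ → ℝ) (B : Type*) [L.Structure B] : Prop :=
  ∀ X : Set B, X.Finite → f X.ncard ≤ (delta L X : ℝ)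

/-- `f` is a good function (continuous, increasing, unbounded) certified by the standard
conditions guaranteeing the free amalgamation property for `(K_f, ≤)`: `f` has a
non-increasing right derivative `g` with `g(x) ≤ 1/(x+1)`. -/
structure IsGoodFun (f g : ℝ → ℝ) : Prop where
  cont : ContinuousOn f (Set.Ici 0)
  mono : StrictMonoOn f (Set.Ici 0)
  unbounded : Filter.Tendsto f Filter.atTop Filter.atTop
  rightDeriv : ∀ x ∈ Set.Ici (0 : ℝ), HasDerivWithinAt f (g x) (Set.Ici x) x
  anti : AntitoneOn g (Set.Ici 0)
  bound : ∀ x ∈ Set.Ici (0 : ℝ), g x ≤ 1 / (x + 1)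

/-- Any subset of a structure in a relational language is (the carrier of) a
substructure. -/
def relSub {N : Type*} [L.Structure N] [L.IsRelational] (A : Set N) :
    L.Substructure N where
  carrier := A
  fun_mem := fun {_} f => isEmptyElim f

/-- `N` is the generic structure `M_f` of the amalgamation class `(K_f, ≤)`:
(1) `N` is the union of a chain of finite self-sufficient substructures, all in `K_f`;
(2) (`≤`-extension property) if `A ≤ N` is finite and `A ≤ B ∈ K_f`, then there is a
`≤`-embedding `β : B → N` fixing `A` pointwise. -/
def IsGeneric {N : Type*} [L.Structure N] [L.IsRelational] (f : ℝ → ℝ) : Prop :=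
  (∃ c : ℕ → Set N, Monotone c ∧ (∀ k, (c k).Finite) ∧ (∀ k, SelfSuffM L (c k)) ∧
    (∀ (k : ℕ) (X : Set N), X ⊆ c k → f X.ncard ≤ (delta L X : ℝ)) ∧
    (⋃ k, c k) = Set.univ) ∧
  (∀ A : Set N, A.Finite → SelfSuffM L A →
    ∀ (B : Type) (_ : Fintype B) (_ : L.Structure B), InKf L f B →
      ∀ e : ↥(relSub L A) ↪[L] B,
        SelfSuffIn L (Set.range ⇑e) (Set.univ : Set B) →
        ∃ g : B ↪[L] N, (∀ a : ↥(relSub L A), g (e a) = ↑a) ∧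
          SelfSuffM L (Set.range ⇑g))

/-- Two tuples have the same complete type over `∅`. -/
def sameType {N : Type*} [L.Structure N] {k : ℕ} (a a' : Fin k → N) : Prop :=
  ∀ φ : L.Formula (Fin k), φ.Realize a ↔ φ.Realize a'

/-- The locus `loc(b̄/ā)`: the set of realizations in `N` of the complete type of `b̄`
over `ā`. -/
def locus {N : Type*} [L.Structure N] {k m : ℕ} (a : Fin k → N) (b : Fin m → N) :
    Set (Fin m → N) :=
  {y | sameType L (Fin.append a y) (Fin.append a b)}

/-- A subset of `M` viewed as a subset of the power `M^{Fin 1}`. -/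
def toDef1 (M : Type*) (s : Set M) : Set (Fin 1 → M) := {x | x 0 ∈ s}

/-- Algebraic closure: `b ∈ acl(Z)` iff `b` belongs to some finite `Z`-definable set. -/
def inAcl {M : Type*} [L.Structure M] (Z : Set M) (b : M) : Prop :=
  ∃ s : Set M, b ∈ s ∧ s.Finite ∧ Z.Definable L (toDef1 M s)


/-- An MS-measuring function (Macpherson–Steinhorn measurability, Definition 4.1):
a dimension-measure function `h = (dim, μ)` on the parameter-definable subsets of the
finite powers of `M` satisfying:
(i) nonempty finite sets get `h(X) = (0, |X|)`;
(ii) each formula `φ(x̄, ȳ)` yields only finitely many values `h(φ(x̄, ā))`, each on an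
`∅`-definable set of parameters `ā`;
(iii) the Fubini property for definable surjections.
The measure is normalised so that `μ(M) = 1`, and extended by `μ(∅) = 0`;
`μ` takes positive values on nonempty definable sets. -/
structure MSMeasuring (L : FirstOrder.Language) (M : Type*) [L.Structure M] where
  /-- the dimension of a definable set -/
  dim : ∀ {α : Type} [Fintype α], Set (α → M) → ℕ
  /-- the measure of a definable set -/
  mu : ∀ {α : Type} [Fintype α], Set (α → M) → ℝ
  /-- `h` takes values in `ℕ × ℝ^{>0}` on nonempty definable sets -/
  mu_pos : ∀ {α : Type} [Fintype α] (X : Set (α → M)),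
    (Set.univ : Set M).Definable L X → X.Nonempty → 0 < mu X
  /-- `μ(∅) = 0` -/
  mu_empty : ∀ {α : Type} [Fintype α], mu (∅ : Set (α → M)) = 0
  /-- normalisation: `μ(M) = 1` -/
  mu_norm : mu (Set.univ : Set (Fin 1 → M)) = 1
  /-- (i): nonempty finite sets `X` have `h(X) = (0, |X|)` -/
  finite_case : ∀ {α : Type} [Fintype α] (X : Set (α → M)),
    (Set.univ : Set M).Definable L X → X.Nonempty → X.Finite →
      dim X = 0 ∧ mu X = X.ncard
  /-- (ii), finiteness of the set of values `h(φ(x̄, ā))` -/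
  finite_values : ∀ {α β : Type} [Fintype α] [Fintype β] (φ : L.Formula (α ⊕ β)),
    {v : ℕ × ℝ | ∃ b : β → M,
      {x : α → M | φ.Realize (Sum.elim x b)}.Nonempty ∧
      v = (dim {x : α → M | φ.Realize (Sum.elim x b)},
           mu {x : α → M | φ.Realize (Sum.elim x b)})}.Finite
  /-- (ii), `∅`-definability of the set of parameters giving a fixed value -/
  definable_values : ∀ {α β : Type} [Fintype α] [Fintype β]
    (φ : L.Formula (α ⊕ β)) (v : ℕ × ℝ),
    (∅ : Set M).Definable L
      {b : β → M | {x : α → M | φ.Realize (Sum.elim x b)}.Nonempty ∧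
        (dim {x : α → M | φ.Realize (Sum.elim x b)},
         mu {x : α → M | φ.Realize (Sum.elim x b)}) = v}
  /-- (iii): the Fubini property for definable surjections -/
  fubini : ∀ {α β : Type} [Fintype α] [Fintype β]
    (X : Set (α → M)) (Y : Set (β → M)) (f : (α → M) → (β → M)),
    X.Nonempty →
    (Set.univ : Set M).Definable L X →
    (Set.univ : Set M).Definable L Y →
    (Set.univ : Set M).Definable L
      {p : α ⊕ β → M | (p ∘ Sum.inl) ∈ X ∧ f (p ∘ Sum.inl) = p ∘ Sum.inr} →
    f '' X = Y →
    ∀ (r : ℕ) (Ys : Fin r → Set (β → M)) (d e : Fin r → ℕ) (mf nf : Fin r → ℝ),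
      (∀ i, (Ys i).Nonempty) →
      (∀ i, (Set.univ : Set M).Definable L (Ys i)) →
      (∀ i j, i ≠ j → Disjoint (Ys i) (Ys j)) →
      (⋃ i, Ys i) = Y →
      (∀ i, ∀ y ∈ Ys i, dim (f ⁻¹' {y} ∩ X) = d i ∧ mu (f ⁻¹' {y} ∩ X) = mf i) →
      (∀ i, dim (Ys i) = e i ∧ mu (Ys i) = nf i) →
      ∀ c : ℕ, (∀ i, d i + e i ≤ c) → (∃ i, d i + e i = c) →
        dim X = c ∧
        mu X = ∑ i ∈ Finset.univ.filter (fun i => d i + e i = c), mf i * nf i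

set_option linter.unusedSectionVars false
set_option linter.unusedVariables false

section Predim

variable {L}
variable {M : Type*} [L.Structure M]

/-- relation instances inside `A` -/
def relS (L : FirstOrder.Language) {M : Type*} [L.Structure M] (A : Set M) :
    Set (Σ n, L.Relations n × (Fin n → M)) :=
  {p | (∀ i, p.2.2 i ∈ A) ∧ Language.Structure.RelMap p.2.1 p.2.2}

lemma delta_eq (A : Set M) : delta L A = (A.ncard : ℤ) - ((relS L A).ncard : ℤ) := rfl

lemma relS_mono {A B : Set M} (h : A ⊆ B) : relS L A ⊆ relS L B :=
  fun _ hp => ⟨fun i => h (hp.1 i), hp.2⟩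

lemma relS_inter (A B : Set M) : relS L (A ∩ B) = relS L A ∩ relS L B := by
  ext p; simp only [relS, Set.mem_ofPred_eq, Set.mem_inter_iff]
  constructor
  · rintro ⟨h, h2⟩; exact ⟨⟨fun i => (h i).1, h2⟩, ⟨fun i => (h i).2, h2⟩⟩
  · rintro ⟨⟨h, h2⟩, ⟨h', _⟩⟩; exact ⟨fun i => ⟨h i, h' i⟩, h2⟩

lemma relS_finite [Finite (Σ n, L.Relations n)] {A : Set M} (hA : A.Finite) :
    (relS L A).Finite := by
  have : relS L A ⊆ ⋃ p : (Σ n, L.Relations n),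
      (fun t : Fin p.1 → M => (⟨p.1, p.2, t⟩ : Σ n, L.Relations n × (Fin n → M))) ''
        {t | ∀ i, t i ∈ A} := by
    rintro ⟨n, r, t⟩ ⟨h, _⟩
    exact Set.mem_iUnion.2 ⟨⟨n, r⟩, t, h, rfl⟩
  refine Set.Finite.subset (Set.finite_iUnion fun p => Set.Finite.image _ ?_) this
  exact Set.Finite.pi' (fun _ => hA)

variable [Finite (Σ n, L.Relations n)]

lemma delta_submod {A B : Set M} (hA : A.Finite) (hB : B.Finite) :
    delta L (A ∪ B) + delta L (A ∩ B) ≤ delta L A + delta L B := by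
  have h1 := Set.ncard_union_add_ncard_inter A B hA hB
  have h2 := Set.ncard_union_add_ncard_inter (relS L A) (relS L B) (relS_finite hA)
    (relS_finite hB)
  rw [← relS_inter] at h2
  have h3 : (relS L A ∪ relS L B).ncard ≤ (relS L (A ∪ B)).ncard :=
    Set.ncard_le_ncard (Set.union_subset (relS_mono Set.subset_union_left)
      (relS_mono Set.subset_union_right)) (relS_finite (hA.union hB))
  simp only [delta_eq]
  omega

lemma delta_union_le {A B : Set M} (hA : A.Finite) (hB : B.Finite) (hAB : A ⊆ B) :
    delta L B ≤ delta L A + ((B \ A).ncard : ℤ) := by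
  have h1 := Set.ncard_sdiff_add_ncard_of_subset hAB hB
  have h3 : (relS L A).ncard ≤ (relS L B).ncard :=
    Set.ncard_le_ncard (relS_mono hAB) (relS_finite hB)
  simp only [delta_eq]
  omega

/-- finite closed sets -/
lemma ss_of_fin {A : Set M} (hA : A.Finite)
    (h : ∀ B : Set M, B.Finite → A ⊂ B → delta L A < delta L B) : SelfSuffM L A := by
  intro X hX
  refine ⟨Set.inter_subset_right, fun B' h1 h2 h3 => ?_⟩
  have e : A ∩ X = A ∩ B' := by
    apply Set.Subset.antisymm
    · exact fun x hx => ⟨hx.1, h1.1 hx⟩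
    · exact fun x hx => ⟨hx.1, h2 hx.2⟩
  rw [e] at h1 ⊢
  have h4 := delta_submod (L := L) hA h3
  have h5 : A ⊂ A ∪ B' := by
    refine ⟨Set.subset_union_left, fun h' => h1.2 fun x hx => ⟨h' (Or.inr hx), hx⟩⟩
  have := h _ (hA.union h3) h5
  omega

lemma ss_lt {A : Set M} (h : SelfSuffM L A) {Z : Set M} (hZ : Z.Finite) (h' : ¬ Z ⊆ A) :
    delta L (A ∩ Z) < delta L Z := by
  refine (h Z hZ).2 Z ?_ subset_rfl hZ
  exact ⟨Set.inter_subset_right, fun h2 => h' fun x hx => (h2 hx).1⟩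

lemma ss_le {A : Set M} (h : SelfSuffM L A) {Z : Set M} (hZ : Z.Finite) :
    delta L (A ∩ Z) ≤ delta L Z := by
  by_cases h' : Z ⊆ A
  · rw [Set.inter_eq_right.2 h']
  · exact (ss_lt h hZ h').le

lemma ss_lt_sup {A : Set M} (h : SelfSuffM L A) {Z : Set M} (hZ : Z.Finite) (h' : A ⊂ Z) :
    delta L A < delta L Z := by
  have := ss_lt h hZ h'.2
  rwa [Set.inter_eq_left.2 h'.1] at this

lemma ss_trans {A B : Set M} (hA : B.Finite) (h : SelfSuffIn L A B) (hB : SelfSuffM L B) :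
    SelfSuffM L A := by
  refine ss_of_fin (hA.subset h.1) fun Z hZ hAZ => ?_
  have h1 := ss_le hB hZ
  by_cases h2 : A = B ∩ Z
  · by_cases h3 : Z ⊆ B
    · exact absurd (h2 ▸ (Set.inter_eq_right.2 h3)) hAZ.ne
    · rw [h2]; exact ss_lt hB hZ h3
  · have : A ⊂ B ∩ Z := by
      refine ssubset_of_subset_of_ne ?_ h2
      exact Set.subset_inter h.1 hAZ.1
    exact (h.2 _ this Set.inter_subset_left (hZ.subset Set.inter_subset_right)).trans_le h1

/-- closures exist -/
lemma cl_spec_aux {X : Set M} (hex : ∃ A : Set M, A.Finite ∧ SelfSuffM L A ∧ X ⊆ A) :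
    (clM L X).Finite ∧ SelfSuffM L (clM L X) := by
  classical
  have hex' : ∃ n, ∃ A : Set M, A.Finite ∧ SelfSuffM L A ∧ X ⊆ A ∧ A.ncard = n := by
    obtain ⟨A, h1, h2, h3⟩ := hex
    exact ⟨_, A, h1, h2, h3, rfl⟩
  obtain ⟨A, h1, h2, h3, h4⟩ := Nat.find_spec hex'
  have : clM L X = A := by
    apply Set.Subset.antisymm
    · exact Set.sInter_subset_of_mem ⟨h3, h2⟩
    · refine Set.subset_sInter ?_
      rintro A' ⟨h5, h6⟩
      have h7 : SelfSuffM L (A' ∩ A) := ss_trans h1 (h6 A h1) h2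
      by_contra h8
      have h9 : A' ∩ A ⊂ A := ⟨Set.inter_subset_right, fun h => h8 fun x hx => (h hx).1⟩
      have h10 := Set.ncard_lt_ncard h9 h1
      rw [h4] at h10
      exact Nat.find_min hex' h10 ⟨_, h1.subset Set.inter_subset_right, h7,
        Set.subset_inter h5 h3, rfl⟩
  rw [this]; exact ⟨h1, h2⟩

lemma subset_cl (X : Set M) : X ⊆ clM L X := Set.subset_sInter fun _ h => h.1

lemma cl_min {X A : Set M} (h : X ⊆ A) (hA : SelfSuffM L A) : clM L X ⊆ A :=
  Set.sInter_subset_of_mem ⟨h, hA⟩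

/-- transfer of `delta` under embeddings -/
lemma delta_image {M' : Type*} [L.Structure M'] (h : M ↪[L] M') (X : Set M) :
    delta L (h '' X) = delta L X := by
  rw [delta_eq, delta_eq, Set.ncard_image_of_injective _ h.injective]
  congr 2
  have hinj : Function.Injective (fun p : (Σ n, L.Relations n × (Fin n → M)) =>
      (⟨p.1, p.2.1, h ∘ p.2.2⟩ : Σ n, L.Relations n × (Fin n → M'))) := by
    rintro ⟨n, r, t⟩ ⟨n', r', t'⟩ he
    simp only [Sigma.mk.injEq] at he
    obtain ⟨rfl, he⟩ := he
    simp only [heq_eq_eq, Prod.mk.injEq] at he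
    obtain ⟨rfl, he⟩ := he
    rw [h.injective.comp_left he]
  rw [← Set.ncard_image_of_injective _ hinj]
  congr 1
  ext ⟨n, r, t⟩
  simp only [relS, Set.mem_ofPred_eq, Set.mem_image]
  constructor
  · rintro ⟨h1, h2⟩
    choose s hs hs2 using h1
    have : h ∘ s = t := funext hs2
    subst this
    exact ⟨⟨n, r, s⟩, ⟨hs, (h.map_rel r s).1 h2⟩, rfl⟩
  · rintro ⟨⟨n', r', t'⟩, ⟨h1, h2⟩, he⟩
    simp only [Sigma.mk.injEq] at he
    obtain ⟨rfl, he⟩ := he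
    simp only [heq_eq_eq, Prod.mk.injEq] at he
    obtain ⟨rfl, rfl⟩ := he
    exact ⟨fun i => ⟨_, h1 i, rfl⟩, (h.map_rel _ _).2 h2⟩

/-- A closed subset of a closed substructure is closed. -/
lemma ss_image {M' : Type*} [L.Structure M'] [Finite M] (h : M ↪[L] M')
    (hr : SelfSuffM L (Set.range h)) {X : Set M}
    (hX : ∀ Y : Set M, X ⊂ Y → delta L X < delta L Y) : SelfSuffM L (h '' X) := by
  refine ss_trans (Set.finite_range h) ⟨Set.image_subset_range _ _, fun B' h1 h2 _ => ?_⟩ hr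
  obtain ⟨Y, rfl⟩ := Set.subset_range_iff_exists_image_eq.1 h2
  rw [delta_image, delta_image]
  refine hX Y ⟨(Set.image_subset_image_iff h.injective).1 h1.1, fun h' => h1.2 ?_⟩
  exact Set.image_mono h'

/-- If two of the three points of a relation are in a closed set, so is the middle one. -/
lemma rel_mem {W : Set M} (hfin : W.Finite) (hW : SelfSuffM L W) (R3 : L.Relations 3) {x y z : M}
    (hR : Language.Structure.RelMap R3 ![x, y, z]) (hx : x ∈ W) (hz : z ∈ W) : y ∈ W := by
  by_contra hy
  have h1 : W ⊂ insert y W := Set.ssubset_insert hy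
  have h2 := ss_lt_sup hW (hfin.insert y) h1
  have h3 : relS L W ⊂ relS L (insert y W) := by
    refine ⟨relS_mono h1.1, fun h => ?_⟩
    have : (⟨3, R3, ![x, y, z]⟩ : Σ n, L.Relations n × (Fin n → M)) ∈ relS L (insert y W) := by
      refine ⟨fun i => ?_, hR⟩
      fin_cases i <;> simp [hx, hz]
    exact hy ((h this).1 1)
  have h4 := Set.ncard_lt_ncard h3 (relS_finite (hfin.insert y))
  have h5 := Set.ncard_insert_of_notMem hy hfin
  simp only [delta_eq] at h2
  omega

end Predim

section Generic

variable {L}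
variable [L.IsRelational] [Finite (Σ n, L.Relations n)]
variable {N : Type} [L.Structure N] {f : ℝ → ℝ}

lemma gen_fin (hgen : IsGeneric L (N := N) f) {X : Set N} (hX : X.Finite) :
    ∃ A : Set N, A.Finite ∧ SelfSuffM L A ∧ X ⊆ A ∧
      ∀ Y ⊆ A, f Y.ncard ≤ (delta L Y : ℝ) := by
  obtain ⟨⟨c, hm, hf, hs, hk, hu⟩, -⟩ := hgen
  have : ∃ k, X ⊆ c k := by
    induction X, hX using Set.Finite.induction_on with
    | empty => exact ⟨0, Set.empty_subset _⟩
    | @insert a s _ _ ih =>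
      obtain ⟨k, hk⟩ := ih
      have ha : a ∈ ⋃ k, c k := hu ▸ Set.mem_univ a
      obtain ⟨l, hl⟩ := Set.mem_iUnion.1 ha
      refine ⟨max k l, Set.insert_subset (hm (le_max_right _ _) hl)
        (hk.trans (hm (le_max_left _ _)))⟩
  obtain ⟨k, hk'⟩ := this
  exact ⟨c k, hf k, hs k, hk', hk k⟩

lemma gen_K (hgen : IsGeneric L (N := N) f) {X : Set N} (hX : X.Finite) :
    f X.ncard ≤ (delta L X : ℝ) := by
  obtain ⟨A, _, _, h, h'⟩ := gen_fin hgen hX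
  exact h' X h

lemma cl_fin (hgen : IsGeneric L (N := N) f) {X : Set N} (hX : X.Finite) :
    (clM L X).Finite := by
  obtain ⟨A, h1, h2, h, h'⟩ := gen_fin hgen hX
  exact (cl_spec_aux ⟨A, h1, h2, h⟩).1

lemma cl_ss (hgen : IsGeneric L (N := N) f) {X : Set N} (hX : X.Finite) :
    SelfSuffM L (clM L X) := by
  obtain ⟨A, h1, h2, h, h'⟩ := gen_fin hgen hX
  exact (cl_spec_aux ⟨A, h1, h2, h⟩).2

lemma dM_le (hgen : IsGeneric L (N := N) f) {X Z : Set N} (hZ : Z.Finite) (h : X ⊆ Z) :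
    dM L X ≤ delta L Z := by
  have hX := hZ.subset h
  obtain ⟨C, hC, hCs, hZC, -⟩ := gen_fin hgen hZ
  have hfin : {Y : Set N | X ⊆ Y ∧ Y ⊆ C}.Finite :=
    hC.finite_subsets.subset fun Y hY => hY.2
  obtain ⟨Y, ⟨hXY, hYC⟩, hmin⟩ := Set.exists_min_image _
    (fun Y : Set N => delta L Y * (C.ncard + 1) - Y.ncard) hfin ⟨Z, h, hZC⟩
  have hYc : SelfSuffM L Y := by
    refine ss_trans hC ⟨hYC, fun B' h1 h2 h3 => ?_⟩ hCs
    by_contra h4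
    push Not at h4
    have h5 := hmin B' ⟨hXY.trans h1.1, h2⟩
    have h6 := Set.ncard_lt_ncard h1 h3
    beta_reduce at h5
    nlinarith
  have h1 : delta L (clM L X) ≤ delta L Y := by
    have := ss_le (cl_ss hgen hX) (hC.subset hYC)
    rwa [Set.inter_eq_left.2 (cl_min hXY hYc)] at this
  refine h1.trans ?_
  by_contra h2
  push Not at h2
  have h3 := hmin Z ⟨h, hZC⟩
  beta_reduce at h3
  have h4 := Set.ncard_le_ncard hYC hC
  nlinarith

/-- Partial isomorphisms between finite closed sets, given by tuples. -/
structure BF (L : FirstOrder.Language) {N : Type} [L.Structure N] {ι : Type} (u u' : ι → N) :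
    Prop where
  eq : ∀ i j, u i = u j ↔ u' i = u' j
  rel : ∀ {n : ℕ} (r : L.Relations n) (t : Fin n → ι),
    Language.Structure.RelMap r (u ∘ t) ↔ Language.Structure.RelMap r (u' ∘ t)
  fin : (Set.range u).Finite
  fin' : (Set.range u').Finite
  cl : SelfSuffM L (Set.range u)
  cl' : SelfSuffM L (Set.range u')

lemma BF.symm {ι : Type} {u u' : ι → N} (h : BF L u u') : BF L u' u :=
  ⟨fun i j => (h.eq i j).symm, fun r t => (h.rel r t).symm, h.fin', h.fin, h.cl', h.cl⟩

lemma BF.of_emb {C : Set N} (hC : C.Finite) (hCs : SelfSuffM L C) (g : ↥(relSub L C) ↪[L] N)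
    (hg : SelfSuffM L (Set.range g)) :
    BF L (Subtype.val : ↥(relSub L C) → N) g := by
  have : Finite ↥(relSub L C) := hC
  have hr : Set.range (Subtype.val : ↥(relSub L C) → N) = C := Subtype.range_coe
  refine ⟨fun i j => ?_, fun r t => ?_, ?_, Set.finite_range _, ?_, hg⟩
  · rw [g.injective.eq_iff, Subtype.val_inj]
  · exact (g.map_rel r t).symm
  · rw [hr]; exact hC
  · rw [hr]; exact hCs

lemma BF.forth (hgen : IsGeneric L (N := N) f) {ι : Type} {u u' : ι → N} (h : BF L u u') (x : N) :
    ∃ (C : Set N) (g : ↥(relSub L C) ↪[L] N),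
      BF L (Subtype.val : ↥(relSub L C) → N) g ∧
      ∃ s : ι → ↥(relSub L C), (∀ i, (s i : N) = u i) ∧ (∀ i, g (s i) = u' i) ∧ x ∈ C := by
  classical
  have hfin : (insert x (Set.range u)).Finite := h.fin.insert x
  set C := clM L (insert x (Set.range u)) with hCdef
  have hC : C.Finite := cl_fin hgen hfin
  have hCs : SelfSuffM L C := cl_ss hgen hfin
  have hsub : insert x (Set.range u) ⊆ C := subset_cl _
  have hmem : ∀ i, u i ∈ C := fun i => hsub (Or.inr ⟨i, rfl⟩)
  let s : ι → ↥(relSub L C) := fun i => ⟨u i, hmem i⟩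
  have : Finite ↥(relSub L C) := hC
  have := Fintype.ofFinite ↥(relSub L C)
  have hp : ∀ y : ↥(relSub L (Set.range u')), ∃ i, u' i = y := fun y => y.2
  choose p hp using hp
  let e : ↥(relSub L (Set.range u')) ↪[L] ↥(relSub L C) :=
    { toFun := fun y => s (p y)
      inj' := by
        intro y z hyz
        have : u (p y) = u (p z) := congrArg Subtype.val hyz
        rw [h.eq, hp, hp] at this
        exact Subtype.ext this
      map_fun' := fun f => isEmptyElim f
      map_rel' := by
        intro n r t
        have h1 := h.rel r (p ∘ t)
        have h2 : u' ∘ p ∘ t = Subtype.val ∘ t := funext fun i => hp _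
        rw [h2] at h1
        exact h1 }
  have he : ∀ y, e y = s (p y) := fun _ => rfl
  have hes : ∀ i, e ⟨u' i, i, rfl⟩ = s i := by
    intro i
    rw [he]
    apply Subtype.ext
    change u _ = u i
    rw [h.eq, hp]
  have hran : Subtype.val '' (Set.range e) = Set.range u := by
    ext z
    constructor
    · rintro ⟨_, ⟨y, rfl⟩, rfl⟩; exact ⟨p y, rfl⟩
    · rintro ⟨i, rfl⟩; exact ⟨s i, ⟨_, hes i⟩, rfl⟩
  have hK : InKf L f ↥(relSub L C) := by
    intro X hX
    have h1 := gen_K hgen (hX.image Subtype.val)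
    rw [Set.ncard_image_of_injective _ Subtype.val_injective] at h1
    have h2 := delta_image (relSub L C).subtype X
    rw [← h2]; exact h1
  have hss : SelfSuffIn L (Set.range e) Set.univ := by
    refine ⟨Set.subset_univ _, fun B' h1 _ h3 => ?_⟩
    have h2 := delta_image (relSub L C).subtype B'
    have h2' := delta_image (relSub L C).subtype (Set.range e)
    rw [← h2, ← h2']
    have hran' : (relSub L C).subtype '' (Set.range e) = Set.range u := hran
    rw [hran']
    refine ss_lt_sup h.cl (h3.image _) ?_
    rw [← hran']
    exact ⟨Set.image_mono h1.1, fun h' => h1.2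
      ((Set.image_subset_image_iff (relSub L C).subtype.injective).1 h')⟩
  obtain ⟨g, hg, hgs⟩ := hgen.2 _ h.fin' h.cl' ↥(relSub L C) this inferInstance hK e hss
  refine ⟨C, g, BF.of_emb hC hCs g hgs, s, fun i => rfl, fun i => ?_, hsub (Or.inl rfl)⟩
  rw [← hes i, hg]

lemma term_var {α : Type*} (t : L.Term α) : ∃ v, t = Language.Term.var v := by
  cases t with
  | var v => exact ⟨v, rfl⟩
  | func f _ => exact isEmptyElim f

lemma BF.realize (hgen : IsGeneric L (N := N) f) {α : Type} {n : ℕ} (φ : L.BoundedFormula α n) :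
    ∀ {ι : Type} {u u' : ι → N} (_ : BF L u u') (s : α → ι) (t : Fin n → ι),
      φ.Realize (u ∘ s) (u ∘ t) ↔ φ.Realize (u' ∘ s) (u' ∘ t) := by
  induction φ with
  | falsum => intros; rfl
  | equal t₁ t₂ =>
    intro ι u u' h s t
    obtain ⟨v, rfl⟩ := term_var t₁
    obtain ⟨w, rfl⟩ := term_var t₂
    have := h.eq (Sum.elim s t v) (Sum.elim s t w)
    simp only [Language.BoundedFormula.Realize, Language.Term.realize_var, ← Sum.comp_elim]
    exact this
  | rel r ts =>
    intro ι u u' h s t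
    choose v hv using fun i => term_var (ts i)
    simp only [Language.BoundedFormula.Realize, hv, Language.Term.realize_var, ← Sum.comp_elim]
    exact h.rel r (fun i => Sum.elim s t (v i))
  | imp φ ψ ih1 ih2 =>
    intro ι u u' h s t
    simp only [Language.BoundedFormula.realize_imp, ih1 h s t, ih2 h s t]
  | all φ ih =>
    have key : ∀ {ι : Type} {u u' : ι → N} (_ : BF L u u') (s : α → ι) (t : Fin _ → ι),
      φ.all.Realize (u' ∘ s) (u' ∘ t) → φ.all.Realize (u ∘ s) (u ∘ t) := by
      intro ι u u' h s t hr x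
      obtain ⟨C, g, hB, q, hq1, hq2, hx⟩ := h.forth hgen x
      have h1 : u ∘ s = Subtype.val ∘ (q ∘ s) := funext fun i => (hq1 _).symm
      have h2 : u' ∘ s = g ∘ (q ∘ s) := funext fun i => (hq2 _).symm
      have h3 : Fin.snoc (u ∘ t) x = Subtype.val ∘
          (Fin.snoc (α := fun _ => ↥(relSub L C)) (q ∘ t) ⟨x, hx⟩) := by
        rw [Fin.comp_snoc]
        congr 1
        exact funext fun i => (hq1 _).symm
      have h4 : Fin.snoc (α := fun _ => N) (u' ∘ t) (g ⟨x, hx⟩) = g ∘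
          (Fin.snoc (α := fun _ => ↥(relSub L C)) (q ∘ t) ⟨x, hx⟩) := by
        rw [Fin.comp_snoc]
        congr 1
        exact funext fun i => (hq2 _).symm
      have h5 := hr (g ⟨x, hx⟩)
      rw [h4, h2] at h5
      rw [h1, h3]
      exact (ih hB _ _).2 h5
    intro ι u u' h s t
    exact ⟨key h.symm s t, key h s t⟩

/-- same type, arbitrary index type -/
def ST (L : FirstOrder.Language) {N : Type} [L.Structure N] {ι : Type} (u v : ι → N) : Prop :=
  ∀ φ : L.Formula ι, φ.Realize u ↔ φ.Realize v

lemma BF.st (hgen : IsGeneric L (N := N) f) {ι α : Type} {u u' : ι → N} (h : BF L u u')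
    (s : α → ι) : ST L (u ∘ s) (u' ∘ s) := by
  intro φ
  have := BF.realize hgen φ h s Fin.elim0
  unfold Language.Formula.Realize
  convert this

lemma ST.refl {ι : Type} (u : ι → N) : ST L u u := fun _ => Iff.rfl
lemma ST.symm {ι : Type} {u v : ι → N} (h : ST L u v) : ST L v u := fun φ => (h φ).symm
lemma ST.trans {ι : Type} {u v w : ι → N} (h : ST L u v) (h' : ST L v w) : ST L u w :=
  fun φ => (h φ).trans (h' φ)
lemma ST.comp {ι κ : Type} {u v : ι → N} (h : ST L u v) (s : κ → ι) : ST L (u ∘ s) (v ∘ s) := by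
  intro φ
  have := h (φ.relabel s)
  simpa [Language.Formula.realize_relabel] using this

end Generic

section Types

variable {L}
variable [L.IsRelational] [Finite (Σ n, L.Relations n)]
variable {N : Type} [L.Structure N] {f : ℝ → ℝ}

lemma fin_types [Nonempty N] (hgen : IsGeneric L (N := N) f)
    (hf : Filter.Tendsto f Filter.atTop Filter.atTop) (ι : Type) [Finite ι] :
    ∃ (T : Type) (_ : Finite T) (code : (ι → N) → T), ∀ u v, code u = code v → ST L u v := by
  classical
  obtain ⟨x0⟩ := ‹Nonempty N›
  obtain ⟨s, hs⟩ := Filter.eventually_atTop.1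
    (hf.eventually_gt_atTop ((Nat.card ι : ℝ) + 1))
  obtain ⟨s', hs'⟩ := exists_nat_ge s
  have key : ∀ u : ι → N, ∃ (w : Fin s' → N) (t : ι → Fin s'), (Set.range w).Finite ∧
      SelfSuffM L (Set.range w) ∧ u = w ∘ t := by
    intro u
    have hfin : (insert x0 (Set.range u)).Finite := (Set.finite_range u).insert x0
    set C := clM L (insert x0 (Set.range u)) with hCdef
    have hC : C.Finite := cl_fin hgen hfin
    have hCs : SelfSuffM L C := cl_ss hgen hfin
    have hsub : insert x0 (Set.range u) ⊆ C := subset_cl _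
    have hcard : C.ncard < s' := by
      by_contra h1
      push Not at h1
      have h2 := hs C.ncard (hs'.trans (by exact_mod_cast h1))
      have h3 := gen_K hgen hC
      have h4 : delta L C ≤ delta L (insert x0 (Set.range u)) := dM_le hgen hfin subset_rfl
      have h5 : delta L (insert x0 (Set.range u)) ≤ Nat.card ι + 1 := by
        rw [delta_eq]
        have h6 := Set.ncard_insert_le x0 (Set.range u)
        have h7 : (Set.range u).ncard ≤ Nat.card ι := by
          rw [← Set.image_univ, ← Set.ncard_univ]
          exact Set.ncard_image_le Set.finite_univ
        omega
      have h8 : (delta L C : ℝ) ≤ Nat.card ι + 1 := by exact_mod_cast h4.trans h5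
      linarith
    have : Finite C := hC
    let e := Finite.equivFin C
    have hn : Nat.card C = C.ncard := Nat.card_coe_set_eq C
    let w : Fin s' → N := fun j => if h : (j : ℕ) < Nat.card C then e.symm ⟨j, h⟩ else x0
    have hw : ∀ c : C, ∃ j, w j = c := by
      intro c
      refine ⟨⟨e c, by have := (e c).2; omega⟩, ?_⟩
      simp only [w, Fin.is_lt, dite_true, Fin.eta]
      rw [Equiv.symm_apply_apply]
    have hr : Set.range w = C := by
      ext z; constructor
      · rintro ⟨j, rfl⟩
        simp only [w]
        split_ifs
        · exact Subtype.coe_prop _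
        · exact hsub (Or.inl rfl)
      · intro hz; exact hw ⟨z, hz⟩
    choose t ht using fun i => hw ⟨u i, hsub (Or.inr ⟨i, rfl⟩)⟩
    exact ⟨w, t, hr ▸ hC, hr ▸ hCs, funext fun i => (ht i).symm⟩
  choose W t h1 h2 h3 using key
  have hF : Finite (Σ l, L.Relations l × (Fin l → Fin s')) := by
    refine Finite.of_injective (β := Σ p : (Σ n, L.Relations n), (Fin p.1 → Fin s'))
      (fun q => ⟨⟨q.1, q.2.1⟩, q.2.2⟩) ?_
    rintro ⟨n, r, t⟩ ⟨n', r', t'⟩ he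
    simp only [Sigma.mk.injEq] at he
    obtain ⟨⟨rfl, h⟩, h'⟩ := he
    simp only [heq_eq_eq] at h h'
    subst h; subst h'; rfl
  let e := Finite.equivFin
    ((ι → Fin s') × Set (Fin s' × Fin s') × Set (Σ l, L.Relations l × (Fin l → Fin s')))
  refine ⟨Fin _, inferInstance, fun u => e (t u, {p | W u p.1 = W u p.2},
      {q | Language.Structure.RelMap q.2.1 (W u ∘ q.2.2)}), ?_⟩
  intro u v he
  have he := e.injective he
  simp only [Prod.mk.injEq] at he
  obtain ⟨e1, e2, e3⟩ := he
  have hB : BF L (W u) (W v) := by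
    refine ⟨fun i j => ?_, fun r q => ?_, h1 u, h1 v, h2 u, h2 v⟩
    · exact Set.ext_iff.1 e2 (i, j)
    · exact Set.ext_iff.1 e3 ⟨_, r, q⟩
  have := hB.st hgen (t u)
  rw [← h3 u, e1, ← h3 v] at this
  exact this

/-- standing hypothesis: finitely many types -/
def FT (L : FirstOrder.Language) (N : Type) [L.Structure N] : Prop :=
  ∀ (ι : Type) [Finite ι], ∃ (T : Type) (_ : Finite T) (code : (ι → N) → T),
    ∀ u v, code u = code v → ST L u v

lemma def_fin_inter {A : Set N} {ι α : Type} [Finite ι] {s : ι → Set (α → N)}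
    (h : ∀ i, A.Definable L (s i)) : A.Definable L (⋂ i, s i) := by
  exact Set.definable_iInter_of_finite h

lemma ST_def (hFT : FT L N) {ι : Type} [Finite ι] (v : ι → N) :
    (∅ : Set N).Definable L {u | ST L u v} := by
  classical
  obtain ⟨T, _, code, hc⟩ := hFT ι
  have key : ∀ τ : T, ∃ φ : L.Formula ι, φ.Realize v ∧ 
      ∀ u, code u = τ → ¬ ST L u v → ¬ φ.Realize u := by
    intro τ
    by_cases h : ∃ u, code u = τ ∧ ¬ ST L u v
    · obtain ⟨u, hu, hn⟩ := h
      unfold ST at hn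
      push Not at hn
      obtain ⟨φ, hφ⟩ := hn
      have : ∃ ψ : L.Formula ι, ψ.Realize v ∧ ¬ ψ.Realize u := by
        rcases hφ with ⟨h1, h2⟩ | ⟨h1, h2⟩
        · exact ⟨φ.not, by simpa using h2, by simpa using h1⟩
        · exact ⟨φ, h2, h1⟩
      obtain ⟨ψ, hψ, hψ'⟩ := this
      refine ⟨ψ, hψ, fun u' hu' _ h3 => hψ' ?_⟩
      exact (hc u' u (hu'.trans hu.symm) ψ).1 h3
    · push Not at h
      exact ⟨⊤, by simp, fun u hu hn => absurd (h u hu) hn⟩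
  choose φ h1 h2 using key
  have : {u | ST L u v} = ⋂ τ, {u | (φ τ).Realize u} := by
    ext u
    simp only [Set.mem_ofPred_eq, Set.mem_iInter]
    constructor
    · exact fun h τ => (h _).2 (h1 τ)
    · intro h
      by_contra hn
      exact h2 (code u) u rfl hn (h _)
  rw [this]
  exact def_fin_inter fun τ => Set.empty_definable_iff.2 ⟨φ τ, rfl⟩

lemma ST.mem_iff {ι : Type} {S : Set (ι → N)} (hS : (∅ : Set N).Definable L S) {u v : ι → N}
    (h : ST L u v) : u ∈ S ↔ v ∈ S := by
  obtain ⟨φ, rfl⟩ := Set.empty_definable_iff.1 hS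
  exact h φ

lemma ST.hom (hFT : FT L N) {α β : Type} [Finite α] [Finite β] (s : α → β) {u : α → N} {v : β → N}
    (h : ST L u (v ∘ s)) : ∃ w, ST L w v ∧ w ∘ s = u := by
  have h1 := (ST_def hFT v).image_comp s
  have h2 := (ST.mem_iff h1 h).2 ⟨v, ST.refl v, rfl⟩
  exact h2

lemma def_eq (A : Set N) {ι γ : Type} [Finite γ] (s t : γ → ι) :
    A.Definable L {u : ι → N | u ∘ s = u ∘ t} := by
  have : {u : ι → N | u ∘ s = u ∘ t} = ⋂ c, {u : ι → N | u (s c) = u (t c)} := by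
    ext u; simp [funext_iff]
  rw [this]
  refine def_fin_inter fun c => ?_
  refine ⟨(Language.Term.var (s c)).equal (Language.Term.var (t c)), ?_⟩
  ext u; simp

lemma def_eq_const {ι γ : Type} [Finite γ] (s : γ → ι) (b : γ → N) :
    (Set.univ : Set N).Definable L {u : ι → N | u ∘ s = b} := by
  have : {u : ι → N | u ∘ s = b} = ⋂ c, {u : ι → N | u (s c) = b c} := by
    ext u; simp [funext_iff]
  rw [this]
  refine def_fin_inter fun c => ?_
  refine ⟨(Language.Term.var (s c)).equal
    (Language.Constants.term (L.con (⟨b c, Set.mem_univ _⟩ : (Set.univ : Set N)))), ?_⟩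
  ext u; simp

lemma def_univ {ι : Type} {S : Set (ι → N)} (h : (∅ : Set N).Definable L S) :
    (Set.univ : Set N).Definable L S := h.mono (Set.empty_subset _)

/-- substitution of parameters -/
lemma def_subst {α β : Type} [Finite α] [Finite β] {S : Set (α ⊕ β → N)}
    (hS : (Set.univ : Set N).Definable L S) (b : β → N) :
    (Set.univ : Set N).Definable L {x : α → N | Sum.elim x b ∈ S} := by
  have h1 := (hS.inter (def_eq_const (L := L) Sum.inr b)).image_comp Sum.inl
  convert h1 using 1
  ext x
  constructor
  · intro h
    exact ⟨Sum.elim x b, ⟨h, by ext; rfl⟩, by ext; rfl⟩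
  · rintro ⟨u, ⟨h1, h2⟩, rfl⟩
    have h2 : u ∘ Sum.inr = b := h2
    have : Sum.elim (u ∘ Sum.inl) b = u := by
      rw [← h2]; exact Sum.elim_comp_inl_inr u
    simpa only [Set.mem_ofPred_eq, this] using h1

/-- the locus -/
def Loc (L : FirstOrder.Language) {N : Type} [L.Structure N] {κ β : Type}
    (a : κ → N) (b : β → N) : Set (β → N) :=
  {y | ST L (Sum.elim y a) (Sum.elim b a)}

lemma mem_Loc {κ β : Type} (a : κ → N) (b : β → N) : b ∈ Loc L a b := ST.refl _

lemma Loc_def (hFT : FT L N) {κ β : Type} [Finite κ] [Finite β] (a : κ → N) (b : β → N) :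
    (Set.univ : Set N).Definable L (Loc L a b) :=
  def_subst (def_univ (ST_def hFT (Sum.elim b a))) a

lemma Loc_eq {κ β : Type} {a : κ → N} {b c : β → N} (h : c ∈ Loc L a b) :
    Loc L a c = Loc L a b := by
  ext y
  exact ⟨fun h' => ST.trans h' h, fun h' => ST.trans h' (ST.symm h)⟩

lemma locus_eq {k m : ℕ} (a : Fin k → N) (b : Fin m → N) : locus L a b = Loc L a b := by
  ext y
  have e1 : ∀ z : Fin m → N, Fin.append a z = Sum.elim z a ∘
      (fun i => (finSumFinEquiv.symm i).swap) := by
    intro z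
    ext i
    refine Fin.addCases (fun i => ?_) (fun i => ?_) i <;> simp
  have e2 : ∀ z : Fin m → N, Sum.elim z a = Fin.append a z ∘
      (Sum.elim (Fin.natAdd k) (Fin.castAdd m)) := by
    intro z; ext i; rcases i with i | i <;> simp
  constructor
  · intro h
    have : ST L (Fin.append a y) (Fin.append a b) := h
    have := this.comp (Sum.elim (Fin.natAdd k) (Fin.castAdd m))
    rwa [← e2, ← e2] at this
  · intro h
    have := ST.comp h (fun i => (finSumFinEquiv.symm i).swap)
    rwa [← e1, ← e1] at this

end Types

section Dimension

variable {L}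
variable [L.IsRelational] [Finite (Σ n, L.Relations n)]
variable {N : Type} [L.Structure N]

lemma dim_fib (msd : MSMeasuring L N) {α β : Type} [Fintype α] [Fintype β]
    (X : Set (α → N)) (Y : Set (β → N)) (f : (α → N) → (β → N)) (hne : X.Nonempty)
    (hX : (Set.univ : Set N).Definable L X) (hY : (Set.univ : Set N).Definable L Y)
    (hG : (Set.univ : Set N).Definable L
      {p : α ⊕ β → N | (p ∘ Sum.inl) ∈ X ∧ f (p ∘ Sum.inl) = p ∘ Sum.inr})
    (hi : f '' X = Y) (d : ℕ) (m : ℝ)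
    (hfib : ∀ y ∈ Y, msd.dim (f ⁻¹' {y} ∩ X) = d ∧ msd.mu (f ⁻¹' {y} ∩ X) = m) :
    msd.dim X = d + msd.dim Y := by
  have hYne : Y.Nonempty := hi ▸ hne.image f
  refine (msd.fubini X Y f hne hX hY hG hi 1 (fun _ => Y) (fun _ => d) (fun _ => msd.dim Y)
    (fun _ => m) (fun _ => msd.mu Y) (fun _ => hYne) (fun _ => hY)
    (fun i j hij => absurd (Subsingleton.elim i j) hij) (by simp [Set.iUnion_const])
    (fun _ => hfib) (fun _ => ⟨rfl, rfl⟩) _ (fun _ => le_rfl) ⟨0, rfl⟩).1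

lemma def_singleton {α : Type} [Finite α] (y : α → N) :
    (Set.univ : Set N).Definable L ({y} : Set (α → N)) := by
  have := def_eq_const (L := L) (id : α → α) y
  exact this

lemma single_val (msd : MSMeasuring L N) {α : Type} [Fintype α] (y : α → N) :
    msd.dim ({y} : Set (α → N)) = 0 ∧ msd.mu ({y} : Set (α → N)) = 1 := by
  have := msd.finite_case {y} (def_singleton y) (Set.singleton_nonempty y) (Set.finite_singleton y)
  simpa using this

lemma dim_part (msd : MSMeasuring L N) {α : Type} [Fintype α]
    (X : Set (α → N)) (hne : X.Nonempty) (hX : (Set.univ : Set N).Definable L X)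
    (r : ℕ) (Ys : Fin r → Set (α → N)) (h1 : ∀ i, (Ys i).Nonempty)
    (h2 : ∀ i, (Set.univ : Set N).Definable L (Ys i))
    (h3 : ∀ i j, i ≠ j → Disjoint (Ys i) (Ys j)) (h4 : (⋃ i, Ys i) = X) :
    (∀ i, msd.dim (Ys i) ≤ msd.dim X) ∧ (∃ i, msd.dim (Ys i) = msd.dim X) ∧
    msd.mu X = ∑ i ∈ Finset.univ.filter (fun i => msd.dim (Ys i) = msd.dim X), msd.mu (Ys i) := by
  have hr : Nonempty (Fin r) := by
    obtain ⟨x, hx⟩ := hne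
    rw [← h4] at hx
    obtain ⟨i, _⟩ := Set.mem_iUnion.1 hx
    exact ⟨i⟩
  obtain ⟨i0, hi0⟩ := Finite.exists_max (fun i => msd.dim (Ys i))
  have hG : (Set.univ : Set N).Definable L
      {p : α ⊕ α → N | (p ∘ Sum.inl) ∈ X ∧ id (p ∘ Sum.inl) = p ∘ Sum.inr} :=
    (hX.preimage_comp Sum.inl).inter (def_eq _ Sum.inl Sum.inr)
  have key := msd.fubini X X id hne hX hX hG (Set.image_id X) r Ys (fun _ => 0)
    (fun i => msd.dim (Ys i)) (fun _ => 1) (fun i => msd.mu (Ys i)) h1 h2 h3 h4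
    (by
      intro i y hy
      have : id ⁻¹' {y} ∩ X = {y} := by
        apply Set.inter_eq_left.2
        rintro _ rfl
        rw [← h4]; exact Set.mem_iUnion.2 ⟨i, hy⟩
      rw [this]; exact single_val msd y)
    (fun i => ⟨rfl, rfl⟩) (msd.dim (Ys i0)) (by simpa using hi0) ⟨i0, by simp⟩
  refine ⟨fun i => key.1 ▸ hi0 i, ⟨i0, key.1.symm⟩, ?_⟩
  rw [key.2, key.1]
  simp

lemma dim_two (msd : MSMeasuring L N) {α : Type} [Fintype α]
    {X Y : Set (α → N)} (hne : X.Nonempty) (hX : (Set.univ : Set N).Definable L X)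
    (hY : (Set.univ : Set N).Definable L Y) (h : X ⊆ Y) (hne' : (Y \ X).Nonempty) :
    msd.dim X ≤ msd.dim Y ∧ (msd.dim X = msd.dim Y → msd.mu X ≤ msd.mu Y) := by
  have key := dim_part msd Y (hne.mono h) hY 2 ![X, Y \ X]
    (by intro i; fin_cases i <;> simp [hne, hne'])
    (by intro i; fin_cases i; exacts [hX, hY.sdiff hX])
    (by intro i j hij; fin_cases i <;> fin_cases j <;> simp_all
        · exact Set.disjoint_sdiff_right
        · exact Set.disjoint_sdiff_left)
    (by ext x; simp only [Set.mem_iUnion, Fin.exists_fin_two]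
        simp only [Matrix.cons_val_zero, Matrix.cons_val_one, Set.mem_sdiff]
        constructor
        · rintro (h1 | h1)
          exacts [h h1, h1.1]
        · intro h1; by_cases h2 : x ∈ X
          exacts [Or.inl h2, Or.inr ⟨h1, h2⟩])
  refine ⟨key.1 0, fun he => ?_⟩
  rw [key.2.2]
  have hpos : ∀ i : Fin 2, 0 ≤ msd.mu ((![X, Y \ X] : Fin 2 → Set (α → N)) i) := by
    intro i
    fin_cases i
    · exact (msd.mu_pos _ hX hne).le
    · exact (msd.mu_pos _ (hY.sdiff hX) hne').le
  exact Finset.single_le_sum (f := fun i => msd.mu ((![X, Y \ X] : Fin 2 → Set (α → N)) i))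
    (s := Finset.univ.filter (fun i => msd.dim ((![X, Y \ X] : Fin 2 → Set (α → N)) i)
      = msd.dim Y)) (fun i _ => hpos i) (a := 0)
    (Finset.mem_filter.2 ⟨Finset.mem_univ _, he⟩)

lemma dim_mono (msd : MSMeasuring L N) {α : Type} [Fintype α]
    {X Y : Set (α → N)} (hne : X.Nonempty) (hX : (Set.univ : Set N).Definable L X)
    (hY : (Set.univ : Set N).Definable L Y) (h : X ⊆ Y) : msd.dim X ≤ msd.dim Y := by
  by_cases h' : (Y \ X).Nonempty
  · exact (dim_two msd hne hX hY h h').1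
  · rw [Set.not_nonempty_iff_eq_empty, Set.sdiff_eq_empty] at h'
    rw [Set.Subset.antisymm h h']

lemma def_finite {α : Type} [Finite α] {X : Set (α → N)} (h : X.Finite) :
    (Set.univ : Set N).Definable L X := by
  induction X, h using Set.Finite.induction_on with
  | empty => exact Set.definable_empty
  | insert _ _ ih =>
    rw [Set.insert_eq]
    exact (def_singleton _).union ih

lemma dim_univ_pos (msd : MSMeasuring L N) [Infinite N] :
    1 ≤ msd.dim (Set.univ : Set (Fin 1 → N)) := by
  by_contra hlt
  have h0 : msd.dim (Set.univ : Set (Fin 1 → N)) = 0 := by omega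
  obtain ⟨F, -, hF⟩ := (Set.infinite_univ (α := Fin 1 → N)).exists_subset_ncard_eq 2
  have hfin : F.Finite := Set.finite_of_ncard_ne_zero (by omega)
  have hne : F.Nonempty := by
    rw [← Set.ncard_pos hfin]; omega
  have hd := def_finite (L := L) hfin
  have h1 := msd.finite_case F hd hne hfin
  have hne' : (Set.univ \ F).Nonempty := by
    rw [← Set.compl_eq_univ_sdiff]
    exact hfin.infinite_compl.nonempty
  have h2 := (dim_two msd hne hd Set.definable_univ (Set.subset_univ _) hne').2
    (by rw [h1.1, h0])
  rw [h1.2, msd.mu_norm, hF.2] at h2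
  norm_num at h2

lemma dim_bij (msd : MSMeasuring L N) {α β : Type} [Fintype α] [Fintype β]
    (X : Set (α → N)) (τ : β → α) (hne : X.Nonempty)
    (hX : (Set.univ : Set N).Definable L X) (hinj : ∀ x ∈ X, ∀ y ∈ X, x ∘ τ = y ∘ τ → x = y) :
    msd.dim X = msd.dim ((fun x => x ∘ τ) '' X) := by
  have := dim_fib msd X _ (fun x => x ∘ τ) hne hX (hX.image_comp τ)
    ((hX.preimage_comp Sum.inl).inter (def_eq _ (Sum.inl ∘ τ) Sum.inr)) rfl 0 1 (by
      rintro _ ⟨x, hx, rfl⟩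
      have : (fun x => x ∘ τ) ⁻¹' {x ∘ τ} ∩ X = {x} := by
        ext y; constructor
        · rintro ⟨h1, h2⟩; exact hinj _ h2 _ hx h1
        · rintro rfl; exact ⟨rfl, hx⟩
      rw [this]; exact single_val msd x)
  rw [this, zero_add]

lemma val_inv (msd : MSMeasuring L N) {α β : Type} [Fintype α] [Fintype β]
    {S : Set (α ⊕ β → N)} (hS : (∅ : Set N).Definable L S) {b b' : β → N} (h : ST L b' b)
    (hne : {x : α → N | Sum.elim x b ∈ S}.Nonempty) :
    msd.dim {x : α → N | Sum.elim x b' ∈ S} = msd.dim {x : α → N | Sum.elim x b ∈ S} ∧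
    msd.mu {x : α → N | Sum.elim x b' ∈ S} = msd.mu {x : α → N | Sum.elim x b ∈ S} := by
  obtain ⟨φ, rfl⟩ := Set.empty_definable_iff.1 hS
  have h1 := msd.definable_values φ (msd.dim {x : α → N | Sum.elim x b ∈ Set.ofPred φ.Realize},
    msd.mu {x : α → N | Sum.elim x b ∈ Set.ofPred φ.Realize})
  have h2 := (ST.mem_iff h1 h).2 ⟨hne, rfl⟩
  have h3 := h2.2
  simp only [Prod.mk.injEq] at h3
  exact h3

lemma dim_comp (hFT : FT L N) (msd : MSMeasuring L N) {κ β β' : Type} [Fintype κ] [Fintype β]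
    [Fintype β'] (a : κ → N) (b : β → N) (σ : β' → β) :
    msd.dim (Loc L a b) = msd.dim {x | x ∘ σ = b ∘ σ ∧ x ∈ Loc L a b} +
      msd.dim (Loc L a (b ∘ σ)) := by
  let S : Set (β ⊕ (β' ⊕ κ) → N) := {u | u ∘ (Sum.inl ∘ σ) = u ∘ (Sum.inr ∘ Sum.inl) ∧
    u ∘ (Sum.elim Sum.inl (Sum.inr ∘ Sum.inr)) ∈ {v : β ⊕ κ → N | ST L v (Sum.elim b a)}}
  have hS : (∅ : Set N).Definable L S :=
    (def_eq _ (Sum.inl ∘ σ) (Sum.inr ∘ Sum.inl)).inter ((ST_def hFT (Sum.elim b a)).preimage_comp _)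
  have hfib : ∀ y : β' → N, (fun x : β → N => x ∘ σ) ⁻¹' {y} ∩ Loc L a b =
      {x | Sum.elim x (Sum.elim y a) ∈ S} := by
    intro y
    ext x
    have : Sum.elim x (Sum.elim y a) ∘ (Sum.elim Sum.inl (Sum.inr ∘ Sum.inr)) = Sum.elim x a := by
      ext i; rcases i with i | i <;> rfl
    constructor
    · rintro ⟨h1, h2⟩
      refine ⟨h1, ?_⟩
      rw [this]; exact h2
    · rintro ⟨h1, h2⟩
      rw [this] at h2
      exact ⟨h1, h2⟩
  have himg : (fun x : β → N => x ∘ σ) '' (Loc L a b) = Loc L a (b ∘ σ) := by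
    have hcomp : ∀ x : β → N, Sum.elim x a ∘ (Sum.map σ id) = Sum.elim (x ∘ σ) a := by
      intro x; ext i; rcases i with i | i <;> rfl
    apply Set.Subset.antisymm
    · rintro _ ⟨x, hx, rfl⟩
      have := ST.comp hx (Sum.map σ id)
      rwa [hcomp, hcomp] at this
    · intro y hy
      have hy : ST L (Sum.elim y a) (Sum.elim (b ∘ σ) a) := hy
      rw [← hcomp] at hy
      obtain ⟨w, h1, h2⟩ := ST.hom hFT _ hy
      have h3 : w = Sum.elim (w ∘ Sum.inl) a := by
        ext i; rcases i with i | i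
        · rfl
        · exact congrFun h2 (Sum.inr i)
      refine ⟨w ∘ Sum.inl, ?_, ?_⟩
      · change ST L _ _
        rw [← h3]; exact h1
      · ext i; exact congrFun h2 (Sum.inl i)
  have h0 := hfib (b ∘ σ)
  refine dim_fib msd _ _ (fun x => x ∘ σ) ⟨b, mem_Loc a b⟩ (Loc_def hFT a b) (Loc_def hFT _ _)
    (((Loc_def hFT a b).preimage_comp Sum.inl).inter (def_eq _ (Sum.inl ∘ σ) Sum.inr)) himg _
    (msd.mu {x | x ∘ σ = b ∘ σ ∧ x ∈ Loc L a b}) ?_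
  intro y hy
  have h0' : {x | x ∘ σ = b ∘ σ ∧ x ∈ Loc L a b} =
    {x | Sum.elim x (Sum.elim (b ∘ σ) a) ∈ S} := h0
  rw [hfib y, h0']
  refine val_inv msd hS hy ?_
  rw [← h0]
  exact ⟨b, rfl, mem_Loc a b⟩

lemma dim_add (hFT : FT L N) (msd : MSMeasuring L N) {κ β β' γ : Type} [Fintype κ] [Fintype β]
    [Fintype β'] [Fintype γ] (a : κ → N) (b : β → N) (σ : β' → β) (τ : γ → β)
    (hst : ∀ i, (∃ j, σ j = i) ∨ (∃ j, τ j = i)) :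
    msd.dim (Loc L a b) = msd.dim (Loc L (Sum.elim (b ∘ σ) a) (b ∘ τ)) +
      msd.dim (Loc L a (b ∘ σ)) := by
  rw [dim_comp hFT msd a b σ]
  congr 1
  have hd : (Set.univ : Set N).Definable L {x | x ∘ σ = b ∘ σ ∧ x ∈ Loc L a b} :=
    (def_eq_const σ (b ∘ σ)).inter (Loc_def hFT a b)
  have hne : {x | x ∘ σ = b ∘ σ ∧ x ∈ Loc L a b}.Nonempty := ⟨b, rfl, mem_Loc a b⟩
  rw [dim_bij msd _ τ hne hd]
  · congr 1
    let ρ : γ ⊕ (β' ⊕ κ) → β ⊕ κ := Sum.elim (Sum.inl ∘ τ) (Sum.elim (Sum.inl ∘ σ) Sum.inr)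
    have hρ : ∀ x : β → N, Sum.elim x a ∘ ρ = Sum.elim (x ∘ τ) (Sum.elim (x ∘ σ) a) := by
      intro x; ext i; rcases i with i | i | i <;> rfl
    apply Set.Subset.antisymm
    · rintro _ ⟨x, ⟨hx1, hx⟩, rfl⟩
      have := ST.comp hx ρ
      rw [hρ, hρ, hx1] at this
      exact this
    · intro y hy
      have hy : ST L (Sum.elim y (Sum.elim (b ∘ σ) a))
        (Sum.elim (b ∘ τ) (Sum.elim (b ∘ σ) a)) := hy
      rw [← hρ] at hy
      obtain ⟨w, h1, h2⟩ := ST.hom hFT _ hy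
      have h3 : w = Sum.elim (w ∘ Sum.inl) a := by
        ext i; rcases i with i | i
        · rfl
        · exact congrFun h2 (Sum.inr (Sum.inr i))
      refine ⟨w ∘ Sum.inl, ⟨?_, ?_⟩, ?_⟩
      · ext i; exact congrFun h2 (Sum.inr (Sum.inl i))
      · change ST L _ _
        rw [← h3]; exact h1
      · ext i; exact congrFun h2 (Sum.inl i)
  · rintro x ⟨hx, -⟩ y ⟨hy, -⟩ hxy
    ext i
    rcases hst i with ⟨j, rfl⟩ | ⟨j, rfl⟩
    · exact (congrFun hx j).trans (congrFun hy j).symm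
    · exact congrFun hxy j

lemma dim_sub (hFT : FT L N) (msd : MSMeasuring L N) {κ κ' β : Type} [Fintype κ] [Fintype κ']
    [Fintype β] (a : κ → N) (b : β → N) (σ : κ' → κ) :
    msd.dim (Loc L a b) ≤ msd.dim (Loc L (a ∘ σ) b) := by
  refine dim_mono msd ⟨b, mem_Loc a b⟩ (Loc_def hFT _ _) (Loc_def hFT _ _) fun y hy => ?_
  have := ST.comp hy (Sum.map id σ)
  have hc : ∀ x : β → N, Sum.elim x a ∘ (Sum.map id σ) = Sum.elim x (a ∘ σ) := by
    intro x; ext i; rcases i with i | i <;> rfl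
  rwa [hc, hc] at this

lemma exists_full (hFT : FT L N) (msd : MSMeasuring L N) [Nonempty N] {κ : Type} [Fintype κ]
    (a : κ → N) : ∃ c : Fin 1 → N,
      msd.dim (Loc L a c) = msd.dim (Set.univ : Set (Fin 1 → N)) := by
  classical
  obtain ⟨T, _, code, hc⟩ := hFT (Fin 1 ⊕ κ)
  have hfin : (Set.range fun c : Fin 1 → N => Loc L a c).Finite := by
    have : Set.Finite (Set.range fun c : Fin 1 → N => code (Sum.elim c a)) := Set.toFinite _
    obtain ⟨g, hg⟩ : ∃ g : T → Set (Fin 1 → N), ∀ c, g (code (Sum.elim c a)) = Loc L a c := by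
      refine ⟨fun τ => if h : ∃ c, code (Sum.elim c a) = τ then Loc L a h.choose else ∅, fun c => ?_⟩
      have h : ∃ c', code (Sum.elim c' a) = code (Sum.elim c a) := ⟨c, rfl⟩
      refine (dif_pos h).trans ?_
      exact Loc_eq (hc _ _ h.choose_spec)
    refine (this.image g).subset ?_
    rintro _ ⟨c, rfl⟩
    exact ⟨_, ⟨c, rfl⟩, hg c⟩
  have : Finite (Set.range fun c : Fin 1 → N => Loc L a c) := hfin
  let e := Finite.equivFin (Set.range fun c : Fin 1 → N => Loc L a c)
  have hY : ∀ i, ∃ c, Loc L a c = (e.symm i : Set (Fin 1 → N)) := fun i => (e.symm i).2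
  obtain ⟨-, ⟨i, hi⟩, -⟩ := dim_part msd Set.univ Set.univ_nonempty Set.definable_univ _
    (fun i => (e.symm i : Set (Fin 1 → N)))
    (fun i => by obtain ⟨c, hc⟩ := hY i; rw [← hc]; exact ⟨c, mem_Loc a c⟩)
    (fun i => by obtain ⟨c, hc⟩ := hY i; rw [← hc]; exact Loc_def hFT a c)
    (fun i j hij => by
      obtain ⟨c, hc⟩ := hY i
      obtain ⟨c', hc'⟩ := hY j
      rw [Set.disjoint_left]
      intro x hx hx'
      rw [← hc] at hx
      rw [← hc'] at hx'
      apply hij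
      apply e.symm.injective
      apply Subtype.ext
      rw [← hc, ← hc', ← Loc_eq hx, ← Loc_eq hx'])
    (by
      rw [Set.eq_univ_iff_forall]
      intro x
      refine Set.mem_iUnion.2 ⟨e ⟨Loc L a x, x, rfl⟩, ?_⟩
      rw [Equiv.symm_apply_apply]; exact mem_Loc a x)
  obtain ⟨c, hc⟩ := hY i
  exact ⟨c, by rw [hc, hi]⟩

end Dimension

section FIneq

lemma f_log {f g : ℝ → ℝ} (hf : IsGoodFun f g) {x y : ℝ} (hx : 0 ≤ x) (hxy : x ≤ y) :
    f y ≤ f x + Real.log ((y + 1) / (x + 1)) := by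
  have hd : ∀ t ∈ Set.Icc x y, HasDerivAt (fun t => f x + (Real.log (t + 1) - Real.log (x + 1)))
      (1 / (t + 1)) t := by
    intro t ht
    have h1 : HasDerivAt (fun t : ℝ => t + 1) 1 t := (hasDerivAt_id t).add_const 1
    have ht' : t + 1 ≠ 0 := by linarith [ht.1]
    exact ((h1.log ht').sub_const _).const_add _
  have := image_le_of_deriv_right_le_deriv_boundary (f := f) (f' := g) (a := x) (b := y)
    (hf.cont.mono fun t ht => hx.trans ht.1)
    (fun t ht => hf.rightDeriv t (hx.trans ht.1))
    (B := fun t => f x + (Real.log (t + 1) - Real.log (x + 1)))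
    (B' := fun t => 1 / (t + 1)) (by simp)
    (fun t ht => (hd t ht).continuousAt.continuousWithinAt)
    (fun t ht => (hd t ⟨ht.1, ht.2.le⟩).hasDerivWithinAt)
    (fun t ht => hf.bound t (hx.trans ht.1)) (Set.right_mem_Icc.2 hxy)
  rw [Real.log_div (by linarith) (by linarith)]
  exact this

lemma f_mono {f g : ℝ → ℝ} (hf : IsGoodFun f g) {x y : ℕ} (h : x ≤ y) : f x ≤ f y :=
  hf.mono.monotoneOn (Set.mem_Ici.2 (Nat.cast_nonneg x)) (Set.mem_Ici.2 (Nat.cast_nonneg y))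
    (by exact_mod_cast h)

lemma f_ineq1 {f g : ℝ → ℝ} (hf : IsGoodFun f g) {x y l : ℕ} (hl : 1 ≤ l)
    (h : y + 1 ≤ l * (x + 1)) : f y ≤ f x + ((l : ℝ) - 1) := by
  rcases le_total y x with h' | h'
  · have := f_mono hf h'
    have : (1 : ℝ) ≤ l := by exact_mod_cast hl
    linarith
  · have h1 := f_log hf (x := x) (y := y) (Nat.cast_nonneg x) (by exact_mod_cast h')
    have hx : (0 : ℝ) < (x : ℝ) + 1 := by positivity
    have h2 : ((y : ℝ) + 1) / (x + 1) ≤ l := by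
      rw [div_le_iff₀ hx]; exact_mod_cast h
    have h3 := Real.log_le_sub_one_of_pos (x := ((y : ℝ) + 1) / (x + 1)) (by positivity)
    linarith

lemma f_ineq2 {f g : ℝ → ℝ} (hf : IsGoodFun f g) {x y l : ℕ} (hl : 1 ≤ l)
    (h : y + 1 ≤ 2 * l * (x + 1)) : f y ≤ f x + (l : ℝ) := by
  rcases le_total y x with h' | h'
  · have := f_mono hf h'
    have : (1 : ℝ) ≤ l := by exact_mod_cast hl
    linarith
  · have h1 := f_log hf (x := x) (y := y) (Nat.cast_nonneg x) (by exact_mod_cast h')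
    have hx : (0 : ℝ) < (x : ℝ) + 1 := by positivity
    have hl' : (0 : ℝ) < l := by exact_mod_cast hl
    have h2 : ((y : ℝ) + 1) / (x + 1) ≤ 2 * l := by
      rw [div_le_iff₀ hx]; exact_mod_cast h
    have h3 : Real.log (((y : ℝ) + 1) / (x + 1)) ≤ Real.log (2 * l) :=
      Real.log_le_log (by positivity) h2
    rw [Real.log_mul (by norm_num) hl'.ne'] at h3
    have h4 := Real.log_le_sub_one_of_pos hl'
    have h5 := Real.log_le_sub_one_of_pos (x := (2 : ℝ)) (by norm_num)
    linarith

end FIneq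
section Amalgam

variable {L}
variable [L.IsRelational] [Finite (Σ n, L.Relations n)]
variable {N : Type} [L.Structure N]

/-- carrier of the amalgam -/
abbrev AmG (A B Q : Set N) (n : ℕ) : Type := ↥Q ⊕ ((Fin n × ↥(B \ A)) ⊕ Unit)

/-- the extra point -/
def amE (A B Q : Set N) (n : ℕ) : AmG A B Q n := Sum.inr (Sum.inr ())

open Classical in
/-- the map from `Q` -/
noncomputable def iQ (A B Q : Set N) (n : ℕ) (x : N) : AmG A B Q n :=
  if h : x ∈ Q then Sum.inl ⟨x, h⟩ else amE A B Q n

open Classical in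
/-- the maps from `B` -/
noncomputable def iB (A B Q : Set N) (n : ℕ) (i : Fin n) (x : N) : AmG A B Q n :=
  if x ∈ A then iQ A B Q n x else
    if h : x ∈ B \ A then Sum.inr (Sum.inl (i, ⟨x, h⟩)) else amE A B Q n

/-- the structure on the amalgam -/
abbrev amStr (R3 : L.Relations 3) (A B Q : Set N) (n : ℕ) (b c : Fin n → N) :
    L.Structure (AmG A B Q n) where
  funMap := fun {_} f => isEmptyElim f
  RelMap := fun {k} r t =>
    (∃ s : Fin k → N, (∀ j, s j ∈ Q) ∧ t = iQ A B Q n ∘ s ∧ Language.Structure.RelMap r s) ∨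
    (∃ i, ∃ s : Fin k → N, (∀ j, s j ∈ B) ∧ t = iB A B Q n i ∘ s ∧
      Language.Structure.RelMap r s) ∨
    (∃ i, (⟨k, r, t⟩ : Σ k, L.Relations k × (Fin k → AmG A B Q n)) =
      ⟨3, R3, ![iB A B Q n i (b i), iQ A B Q n (c i), amE A B Q n]⟩)

variable {A B Q : Set N} {n : ℕ}

lemma iQ_of {x : N} (h : x ∈ Q) : iQ A B Q n x = Sum.inl ⟨x, h⟩ := dif_pos h

lemma iB_ofA {i : Fin n} {x : N} (h : x ∈ A) : iB A B Q n i x = iQ A B Q n x := if_pos h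

lemma iB_ofB {i : Fin n} {x : N} (h : x ∈ B \ A) :
    iB A B Q n i x = Sum.inr (Sum.inl (i, ⟨x, h⟩)) := by
  unfold iB
  rw [if_neg h.2, dif_pos h]

lemma iQ_inj {x y : N} (hx : x ∈ Q) (hy : y ∈ Q) (h : iQ A B Q n x = iQ A B Q n y) : x = y := by
  rw [iQ_of hx, iQ_of hy] at h
  simpa using h

lemma iQ_ne {x : N} (hx : x ∈ Q) : iQ A B Q n x ≠ amE A B Q n := by
  rw [iQ_of hx]; simp [amE]

lemma iB_ne (hAQ : A ⊆ Q) {i : Fin n} {x : N} (hx : x ∈ B) : iB A B Q n i x ≠ amE A B Q n := by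
  by_cases h : x ∈ A
  · rw [iB_ofA h]; exact iQ_ne (hAQ h)
  · rw [iB_ofB ⟨hx, h⟩]; simp [amE]

lemma iQB (hAQ : A ⊆ Q) {i : Fin n} {x y : N} (hx : x ∈ Q) (hy : y ∈ B)
    (h : iQ A B Q n x = iB A B Q n i y) : x = y := by
  by_cases h' : y ∈ A
  · rw [iB_ofA h'] at h; exact iQ_inj hx (hAQ h') h
  · rw [iB_ofB ⟨hy, h'⟩, iQ_of hx] at h
    simp at h

lemma iBB (hAQ : A ⊆ Q) {i j : Fin n} {x y : N} (hx : x ∈ B) (hy : y ∈ B)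
    (h : iB A B Q n i x = iB A B Q n j y) : x = y := by
  by_cases h' : y ∈ A
  · rw [iB_ofA h'] at h; exact (iQB hAQ (hAQ h') hx h.symm).symm
  · by_cases h'' : x ∈ A
    · rw [iB_ofA h''] at h; exact iQB hAQ (hAQ h'') hy h
    · rw [iB_ofB ⟨hy, h'⟩, iB_ofB ⟨hx, h''⟩] at h
      simp at h
      exact congrArg Subtype.val h.2

/-- trace on `Q` -/
def tQ (X : Set (AmG A B Q n)) : Set N := {x | x ∈ Q ∧ iQ A B Q n x ∈ X}
/-- trace on `B` -/
def tB (X : Set (AmG A B Q n)) (i : Fin n) : Set N := {x | x ∈ B ∧ iB A B Q n i x ∈ X}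

lemma tB_inter (hAB : A ⊆ B) (hAQ : A ⊆ Q) (X : Set (AmG A B Q n)) (i : Fin n) :
    A ∩ tB X i = A ∩ tQ X := by
  ext x
  constructor
  · rintro ⟨h1, h2, h3⟩
    rw [iB_ofA h1] at h3
    exact ⟨h1, hAQ h1, h3⟩
  · rintro ⟨h1, h2, h3⟩
    refine ⟨h1, hAB h1, ?_⟩
    rw [iB_ofA h1]; exact h3

open Classical in
lemma ncard_sum {G : Type} [Fintype G] (X : Set G) :
    X.ncard = ∑ x : G, if x ∈ X then 1 else 0 := by
  rw [Set.ncard_eq_toFinset_card', ← Finset.card_filter]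
  congr 1
  ext x; simp

open Classical in
lemma am_card (hA : A.Finite) (hB : B.Finite) (hQ : Q.Finite) (hAB : A ⊆ B) (hAQ : A ⊆ Q)
    (X : Set (AmG A B Q n)) :
    (X.ncard : ℤ) = (tQ X).ncard + ∑ i, (((tB X i).ncard : ℤ) - ((A ∩ tQ X).ncard : ℤ)) +
      (if amE A B Q n ∈ X then 1 else 0) := by
  have : Fintype ↥Q := hQ.fintype
  have : Fintype ↥(B \ A) := (hB.subset Set.sdiff_subset).fintype
  have h1 : (tQ X).ncard = ∑ x : ↥Q, if (Sum.inl x : AmG A B Q n) ∈ X then 1 else 0 := by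
    have : tQ X = Subtype.val '' {x : ↥Q | (Sum.inl x : AmG A B Q n) ∈ X} := by
      ext x
      constructor
      · rintro ⟨h, h'⟩
        rw [iQ_of h] at h'
        exact ⟨⟨x, h⟩, h', rfl⟩
      · rintro ⟨⟨x, h⟩, h', rfl⟩
        refine ⟨h, ?_⟩
        rw [iQ_of h]; exact h'
    rw [this, Set.ncard_image_of_injective _ Subtype.val_injective, ncard_sum]
    rfl
  have h2 : ∀ i, ((tB X i).ncard : ℤ) - ((A ∩ tQ X).ncard : ℤ) =
      ((∑ x : ↥(B \ A), if (Sum.inr (Sum.inl (i, x)) : AmG A B Q n) ∈ X then 1 else 0 : ℕ) : ℤ) := by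
    intro i
    have : tB X i \ A = Subtype.val '' {x : ↥(B \ A) |
        (Sum.inr (Sum.inl (i, x)) : AmG A B Q n) ∈ X} := by
      ext x
      constructor
      · rintro ⟨⟨h, h'⟩, h2⟩
        rw [iB_ofB ⟨h, h2⟩] at h'
        exact ⟨⟨x, h, h2⟩, h', rfl⟩
      · rintro ⟨⟨x, h⟩, h', rfl⟩
        refine ⟨⟨h.1, ?_⟩, h.2⟩
        rw [iB_ofB h]; exact h'
    have h3 := Set.ncard_image_of_injective {x : ↥(B \ A) |
        (Sum.inr (Sum.inl (i, x)) : AmG A B Q n) ∈ X} Subtype.val_injective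
    rw [← this] at h3
    rw [← tB_inter hAB hAQ X i]
    have h4 := Set.ncard_inter_add_ncard_sdiff_eq_ncard (tB X i) A (hB.subset fun x hx => hx.1)
    rw [Set.inter_comm] at h4
    have h5 : (tB X i \ A).ncard = ∑ x : ↥(B \ A),
        if (Sum.inr (Sum.inl (i, x)) : AmG A B Q n) ∈ X then 1 else 0 := h3.trans (ncard_sum _)
    rw [← h5]
    omega
  rw [Finset.sum_congr rfl fun i _ => h2 i, h1, ncard_sum, Fintype.sum_sum_type,
    Fintype.sum_sum_type, Fintype.sum_prod_type]
  simp only [Finset.univ_unique, Finset.sum_singleton]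
  push_cast
  have : (Sum.inr (Sum.inr default) : AmG A B Q n) = amE A B Q n := rfl
  rw [this]
  ring

open Classical in
lemma am_delta (R3 : L.Relations 3) (b c : Fin n → N) (hA : A.Finite) (hB : B.Finite)
    (hQ : Q.Finite) (hAB : A ⊆ B) (hAQ : A ⊆ Q) (hb : ∀ i, b i ∈ B) (hc : ∀ i, c i ∈ Q)
    (X : Set (AmG A B Q n)) :
    letI := amStr R3 A B Q n b c
    delta L (tQ X) + ∑ i, (delta L (tB X i) - delta L (A ∩ tQ X)) +
      (if amE A B Q n ∈ X then 1 else 0) -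
      ((Finset.univ.filter fun i => amE A B Q n ∈ X ∧ b i ∈ tB X i ∧ c i ∈ tQ X).card : ℤ)
      ≤ delta L X := by
  let _ := amStr R3 A B Q n b c
  change _ ≤ delta L X
  set J := Finset.univ.filter fun i => amE A B Q n ∈ X ∧ b i ∈ tB X i ∧ c i ∈ tQ X with hJ
  have hYf : (tQ X).Finite := hQ.subset fun x hx => hx.1
  have hZf : ∀ i, (tB X i).Finite := fun i => hB.subset fun x hx => hx.1
  let mQ : (Σ k, L.Relations k × (Fin k → N)) → Σ k, L.Relations k × (Fin k → AmG A B Q n) :=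
    fun p => ⟨p.1, p.2.1, iQ A B Q n ∘ p.2.2⟩
  let mB : Fin n → (Σ k, L.Relations k × (Fin k → N)) →
      Σ k, L.Relations k × (Fin k → AmG A B Q n) :=
    fun i p => ⟨p.1, p.2.1, iB A B Q n i ∘ p.2.2⟩
  let m3 : Fin n → Σ k, L.Relations k × (Fin k → AmG A B Q n) := fun i =>
    ⟨3, R3, ![iB A B Q n i (b i), iQ A B Q n (c i), amE A B Q n]⟩
  have hsub : relS L X ⊆ (mQ '' relS L (tQ X) ∪
      ⋃ i ∈ (Finset.univ : Finset (Fin n)), mB i '' (relS L (tB X i) \ relS L (A ∩ tQ X))) ∪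
      m3 '' (J : Set (Fin n)) := by
    rintro ⟨k, r, t⟩ ⟨h1, h2⟩
    have h1 : ∀ i : Fin k, t i ∈ X := h1
    have h2 : Language.Structure.RelMap r t := h2
    rcases h2 with ⟨s, hs, he, hr⟩ | ⟨i, s, hs, he, hr⟩ | ⟨i, he⟩
    · refine Or.inl (Or.inl ⟨⟨k, r, s⟩, ⟨fun j => ⟨hs j, ?_⟩, hr⟩, ?_⟩)
      · have := h1 j
        have he : t = _ := he
        subst he
        exact this
      · have he : t = _ := he
        subst he; rfl
    · have he : t = _ := he
      subst he
      by_cases hS : (⟨k, r, s⟩ : Σ k, L.Relations k × (Fin k → N)) ∈ relS L (A ∩ tQ X)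
      · refine Or.inl (Or.inl ⟨⟨k, r, s⟩, relS_mono Set.inter_subset_right hS, ?_⟩)
        have : iB A B Q n i ∘ s = iQ A B Q n ∘ s := by
          ext1 j; exact iB_ofA (hS.1 j).1
        simp only [this, mQ]
      · refine Or.inl (Or.inr ?_)
        simp only [Set.mem_iUnion]
        exact ⟨i, Finset.mem_univ _, ⟨k, r, s⟩, ⟨⟨fun j => ⟨hs j, h1 j⟩, hr⟩, hS⟩, rfl⟩
    · refine Or.inr ⟨i, ?_, he.symm⟩
      cases he
      have e0 := h1 0
      have e1 := h1 1
      have e2 := h1 2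
      simp only [hJ, Finset.coe_filter, Finset.mem_univ, true_and]
      exact ⟨e2, ⟨hb i, e0⟩, ⟨hc i, e1⟩⟩
  have hfinU : ∀ i, (mB i '' (relS L (tB X i) \ relS L (A ∩ tQ X))).Finite := fun i =>
    ((relS_finite (hZf i)).subset Set.sdiff_subset).image _
  have c1 : (relS L X).ncard ≤ (relS L (tQ X)).ncard +
      ∑ i, (relS L (tB X i) \ relS L (A ∩ tQ X)).ncard + J.card := by
    refine (Set.ncard_le_ncard hsub ?_).trans ?_
    · refine (((relS_finite hYf).image _).union ?_).union (Set.toFinite _)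
      exact Set.Finite.biUnion (Finset.finite_toSet _) fun i _ => hfinU i
    · refine (Set.ncard_union_le _ _).trans (add_le_add ((Set.ncard_union_le _ _).trans
        (add_le_add (Set.ncard_image_le (relS_finite hYf)) ?_)) ?_)
      · refine (Finset.set_ncard_biUnion_le _ _).trans (Finset.sum_le_sum fun i _ => ?_)
        exact Set.ncard_image_le ((relS_finite (hZf i)).subset Set.sdiff_subset)
      · refine (Set.ncard_image_le (Set.toFinite _)).trans ?_
        rw [Set.ncard_coe_finset]
  have c2 : ∀ i, ((relS L (tB X i) \ relS L (A ∩ tQ X)).ncard : ℤ) =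
      ((relS L (tB X i)).ncard : ℤ) - (relS L (A ∩ tQ X)).ncard := by
    intro i
    have hs : relS L (A ∩ tQ X) ⊆ relS L (tB X i) := by
      rw [← tB_inter hAB hAQ X i]; exact relS_mono Set.inter_subset_right
    have := Set.ncard_sdiff_add_ncard_of_subset hs (relS_finite (hZf i))
    omega
  have c3 : ((relS L X).ncard : ℤ) ≤ (relS L (tQ X)).ncard +
      ∑ i, (((relS L (tB X i)).ncard : ℤ) - (relS L (A ∩ tQ X)).ncard) + J.card := by
    rw [← Finset.sum_congr rfl fun i _ => c2 i]
    exact_mod_cast c1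
  have c4 := am_card hA hB hQ hAB hAQ X
  have c5 : ∑ i, (delta L (tB X i) - delta L (A ∩ tQ X)) =
      ∑ i, (((tB X i).ncard : ℤ) - ((A ∩ tQ X).ncard : ℤ)) -
      ∑ i, (((relS L (tB X i)).ncard : ℤ) - (relS L (A ∩ tQ X)).ncard) := by
    rw [← Finset.sum_sub_distrib]
    refine Finset.sum_congr rfl fun i _ => ?_
    simp only [delta_eq]; ring
  rw [c5, delta_eq (tQ X), delta_eq X, c4]
  linarith

end Amalgam
section Amalgam2

variable {L}
variable [L.IsRelational] [Finite (Σ n, L.Relations n)]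
variable {N : Type} [L.Structure N]

lemma indep_ge {A : Set N} {n : ℕ} {c : Fin n → N} (hA : A.Finite)
    (hind : ∀ U : Set N, U.Finite → A ⊆ U → Set.range c ⊆ U → delta L A + n ≤ delta L U)
    {Y : Set N} (hY : Y.Finite) (J : Finset (Fin n)) (hJ : ∀ i ∈ J, c i ∈ Y) :
    delta L (A ∩ Y) + J.card ≤ delta L Y := by
  classical
  have h1 := delta_submod (L := L) hA hY
  have hAY := hA.union hY
  have hU : (A ∪ Y ∪ Set.range c).Finite := hAY.union (Set.finite_range c)
  have h2 := hind _ hU (fun x hx => Or.inl (Or.inl hx)) (fun x hx => Or.inr hx)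
  have h3 := delta_union_le (L := L) hAY hU Set.subset_union_left
  have h4 : ((A ∪ Y ∪ Set.range c) \ (A ∪ Y)).ncard ≤ (Jᶜ).card := by
    have : (A ∪ Y ∪ Set.range c) \ (A ∪ Y) ⊆ c '' ((Jᶜ : Finset (Fin n)) : Set (Fin n)) := by
      rintro x ⟨hx1 | ⟨i, rfl⟩, hx2⟩
      · exact absurd hx1 hx2
      · refine ⟨i, ?_, rfl⟩
        simp only [Finset.coe_compl, Set.mem_compl_iff, Finset.mem_coe]
        exact fun hi => hx2 (Or.inr (hJ i hi))
    refine (Set.ncard_le_ncard this (Set.toFinite _)).trans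
      ((Set.ncard_image_le (Set.toFinite _)).trans ?_)
    rw [Set.ncard_coe_finset]
  have h5 := Finset.card_add_card_compl J
  simp only [Fintype.card_fin] at h5
  omega

variable {A B Q : Set N} {n : ℕ} {b c : Fin n → N} {f g : ℝ → ℝ}

/-- the data of an amalgamation problem -/
structure AmData (L : FirstOrder.Language) {N : Type} [L.Structure N] (A B Q : Set N) {n : ℕ}
    (b c : Fin n → N) : Prop where
  hA : A.Finite
  hB : B.Finite
  hQ : Q.Finite
  hAB : A ⊆ B
  hAQ : A ⊆ Q
  sA : SelfSuffM L A
  hb : ∀ i, b i ∈ B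
  hbA : ∀ i, b i ∉ A
  hc : ∀ i, c i ∈ Q
  hind : ∀ U : Set N, U.Finite → A ⊆ U → Set.range c ⊆ U → delta L A + n ≤ delta L U

open Classical in
/-- numerical summary of a subset of the amalgam -/
lemma AmData.num (D : AmData L A B Q b c) (R3 : L.Relations 3) (X : Set (AmG A B Q n)) :
    letI := amStr R3 A B Q n b c
    ∃ (I J : Finset (Fin n)), J ⊆ I ∧ (∀ i, i ∈ I ↔ ¬ tB X i ⊆ A) ∧
      (amE A B Q n ∉ X → J = ∅) ∧
      (∀ i, 0 ≤ delta L (tB X i) - delta L (A ∩ tQ X)) ∧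
      (∀ i ∈ I, 1 ≤ delta L (tB X i) - delta L (A ∩ tQ X)) ∧
      delta L (A ∩ tQ X) + J.card ≤ delta L (tQ X) ∧
      delta L (tQ X) + ∑ i ∈ I, (delta L (tB X i) - delta L (A ∩ tQ X)) +
      (if amE A B Q n ∈ X then 1 else 0) - J.card ≤ delta L X ∧
      (X.ncard : ℤ) = (tQ X).ncard + ∑ i ∈ I, (((tB X i).ncard : ℤ) - ((A ∩ tQ X).ncard : ℤ)) +
      (if amE A B Q n ∈ X then 1 else 0) := by
  let _ := amStr R3 A B Q n b c
  have hYf : (tQ X).Finite := D.hQ.subset fun x hx => hx.1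
  have hZf : ∀ i, (tB X i).Finite := fun i => D.hB.subset fun x hx => hx.1
  have hS := tB_inter D.hAB D.hAQ X
  have hout : ∀ i, tB X i ⊆ A → tB X i = A ∩ tQ X := by
    intro i hi
    rw [← hS i, Set.inter_eq_right.2 hi]
  refine ⟨Finset.univ.filter fun i => ¬ tB X i ⊆ A, Finset.univ.filter fun i =>
    amE A B Q n ∈ X ∧ b i ∈ tB X i ∧ c i ∈ tQ X, ?_, ?_, ?_, ?_, ?_, ?_, ?_, ?_⟩
  · intro i hi
    simp only [Finset.mem_filter, Finset.mem_univ, true_and] at hi ⊢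
    exact fun h => D.hbA i (h hi.2.1)
  · intro i; simp
  · intro he; simp [he]
  · intro i
    have := ss_le D.sA (hZf i)
    rw [hS] at this
    omega
  · intro i hi
    simp only [Finset.mem_filter, Finset.mem_univ, true_and] at hi
    have := ss_lt D.sA (hZf i) hi
    rw [hS] at this
    omega
  · refine indep_ge D.hA D.hind hYf _ fun i hi => ?_
    simp only [Finset.mem_filter, Finset.mem_univ, true_and] at hi
    exact hi.2.2
  · have h1 := am_delta R3 b c D.hA D.hB D.hQ D.hAB D.hAQ D.hb D.hc X
    have h2 : ∑ i ∈ Finset.univ.filter (fun i => ¬ tB X i ⊆ A),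
        (delta L (tB X i) - delta L (A ∩ tQ X)) =
        ∑ i, (delta L (tB X i) - delta L (A ∩ tQ X)) := by
      refine Finset.sum_subset (Finset.subset_univ _) fun i _ hi => ?_
      simp only [Finset.mem_filter, Finset.mem_univ, true_and, not_not] at hi
      rw [hout i hi, sub_self]
    rw [h2]
    exact h1
  · have h1 := am_card D.hA D.hB D.hQ D.hAB D.hAQ X
    have h2 : ∑ i ∈ Finset.univ.filter (fun i => ¬ tB X i ⊆ A),
        (((tB X i).ncard : ℤ) - ((A ∩ tQ X).ncard : ℤ)) =
        ∑ i, (((tB X i).ncard : ℤ) - ((A ∩ tQ X).ncard : ℤ)) := by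
      refine Finset.sum_subset (Finset.subset_univ _) fun i _ hi => ?_
      simp only [Finset.mem_filter, Finset.mem_univ, true_and, not_not] at hi
      rw [hout i hi, sub_self]
    rw [h2]
    exact h1

lemma sum_ge_card {n : ℕ} (I : Finset (Fin n)) (t : Fin n → ℤ) (h : ∀ i ∈ I, 1 ≤ t i) :
    (I.card : ℤ) ≤ ∑ i ∈ I, t i := by
  have := Finset.card_nsmul_le_sum I t 1 h
  simpa using this

lemma sum_ge_one {n : ℕ} (I : Finset (Fin n)) (t : Fin n → ℤ) (h : ∀ i ∈ I, 1 ≤ t i) {m : Fin n}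
    (hm : m ∈ I) : t m + ((I.card : ℤ) - 1) ≤ ∑ i ∈ I, t i := by
  classical
  have h1 := Finset.add_sum_erase I t hm
  have h2 := sum_ge_card (I.erase m) t fun i hi => h i (Finset.mem_of_mem_erase hi)
  have h3 := Finset.card_erase_add_one hm
  omega

lemma AmData.inK (D : AmData L A B Q b c) (R3 : L.Relations 3) (hf : IsGoodFun f g)
    (hgen : IsGeneric L (N := N) f) :
    letI := amStr R3 A B Q n b c
    InKf L f (AmG A B Q n) := by
  classical
  let _ := amStr R3 A B Q n b c
  intro X _
  obtain ⟨I, J, hJI, hI, hJe, ht0, ht1, hYJ, hd, hcard⟩ := D.num R3 X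
  have hYf : (tQ X).Finite := D.hQ.subset fun x hx => hx.1
  have hZf : ∀ i, (tB X i).Finite := fun i => D.hB.subset fun x hx => hx.1
  set Y := tQ X
  set S := A ∩ tQ X
  have hJc := Finset.card_le_card hJI
  have hTl := sum_ge_card I _ ht1
  have hKY := gen_K hgen hYf
  have suf1 : ∀ l : ℕ, 1 ≤ l → delta L Y + l ≤ delta L X → X.ncard + 1 ≤ 2 * l * (Y.ncard + 1) →
      f X.ncard ≤ (delta L X : ℝ) := by
    intro l hl h1 h2
    have h3 := f_ineq2 hf hl h2
    have h4 : (delta L Y : ℝ) + l ≤ delta L X := by exact_mod_cast h1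
    linarith
  by_cases hI0 : I = ∅
  · subst hI0
    simp only [Finset.sum_empty, Finset.card_empty] at *
    by_cases he : amE A B Q n ∈ X
    · simp only [if_pos he] at hd hcard
      refine suf1 1 le_rfl ?_ ?_ <;> push_cast <;> omega
    · simp only [if_neg he] at hd hcard
      have h1 : X.ncard = Y.ncard := by omega
      rw [h1]
      have : (delta L Y : ℝ) ≤ delta L X := by exact_mod_cast (by omega)
      linarith
  · have hIne : I.Nonempty := Finset.nonempty_iff_ne_empty.2 hI0
    obtain ⟨m, hm, hmax⟩ := Finset.exists_max_image I (fun i => (tB X i).ncard) hIne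
    have hTm := sum_ge_one I _ ht1 hm
    have hl : 1 ≤ I.card := hIne.card_pos
    have hKZ := gen_K hgen (hZf m)
    have hsum : ∑ i ∈ I, (((tB X i).ncard : ℤ) - (S.ncard : ℤ)) ≤
        I.card * (((tB X m).ncard : ℤ) - S.ncard) := by
      have := Finset.sum_le_card_nsmul I (fun i => (((tB X i).ncard : ℤ) - (S.ncard : ℤ)))
        (((tB X m).ncard : ℤ) - S.ncard) (fun i hi => by have := hmax i hi; omega)
      simpa using this
    set l := I.card
    set z := (tB X m).ncard
    have hsum2 : (l : ℤ) * ((z : ℤ) - S.ncard) ≤ l * z := by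
      have : (0 : ℤ) ≤ (l : ℤ) * S.ncard := by positivity
      linarith [mul_sub (l : ℤ) z S.ncard]
    have suf2 : delta L Y + 1 ≤ delta L X → delta L (tB X m) + l ≤ delta L X →
        f X.ncard ≤ (delta L X : ℝ) := by
      intro h1 h2
      have hX : (X.ncard : ℤ) ≤ Y.ncard + l * z + 1 := by
        rw [hcard]
        split_ifs <;> linarith
      have hX' : X.ncard ≤ Y.ncard + l * z + 1 := by exact_mod_cast hX
      by_cases hc : l * z ≤ Y.ncard
      · exact suf1 1 le_rfl (by exact_mod_cast h1) (by omega)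
      · have h3 : X.ncard + 1 ≤ 2 * l * (z + 1) := by
          have : 2 * l * (z + 1) = 2 * (l * z) + 2 * l := by ring
          omega
        have h4 := f_ineq2 hf hl h3
        have h5 : (delta L (tB X m) : ℝ) + l ≤ delta L X := by exact_mod_cast h2
        linarith
    by_cases he : amE A B Q n ∈ X
    · simp only [if_pos he] at hd hcard
      exact suf2 (by omega) (by omega)
    · simp only [if_neg he] at hd hcard
      have hJ0 := hJe he
      subst hJ0
      simp only [Finset.card_empty] at *
      by_cases hYA : Y ⊆ A
      · have hSY : S = Y := Set.inter_eq_right.2 hYA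
        have h2 : delta L (tB X m) + (l - 1) ≤ delta L X := by
          rw [← hSY] at hd
          push_cast at hd
          omega
        have hX : X.ncard + 1 ≤ l * (z + 1) := by
          have h3 : (l : ℤ) * ((z : ℤ) - S.ncard) = l * z - l * S.ncard := by ring
          have h4 : (S.ncard : ℤ) ≤ l * S.ncard := by
            have : (1 : ℤ) ≤ l := by exact_mod_cast hl
            nlinarith [Int.natCast_nonneg S.ncard]
          have h5 : (X.ncard : ℤ) + 1 ≤ l * z + l := by
            have : (1 : ℤ) ≤ l := by exact_mod_cast hl
            rw [hcard, ← hSY]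
            linarith
          have : (X.ncard : ℤ) + 1 ≤ l * (z + 1) := by linarith [mul_add (l : ℤ) z 1]
          exact_mod_cast this
        have h4 := f_ineq1 hf hl hX
        have h5 : (delta L (tB X m) : ℝ) + (l - 1) ≤ delta L X := by exact_mod_cast h2
        linarith
      · have : delta L S < delta L Y := ss_lt D.sA hYf hYA
        exact suf2 (by push_cast at hd; omega) (by push_cast at hd; omega)

lemma tQ_range_sub {X : Set (AmG A B Q n)} (h : iQ A B Q n '' Q ⊆ X) : tQ X = Q := by
  ext x
  exact ⟨fun h => h.1, fun hx => ⟨hx, h ⟨x, hx, rfl⟩⟩⟩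

lemma tB_range_sub {X : Set (AmG A B Q n)} {i : Fin n} (h : iB A B Q n i '' B ⊆ X) :
    tB X i = B := by
  ext x
  exact ⟨fun h => h.1, fun hx => ⟨hx, h ⟨x, hx, rfl⟩⟩⟩

lemma am_sub {X : Set (AmG A B Q n)} (he : amE A B Q n ∉ X) {x : AmG A B Q n} (hx : x ∈ X) :
    (∃ q ∈ tQ X, x = iQ A B Q n q) ∨ ∃ i, ∃ y ∈ tB X i \ A, x = iB A B Q n i y := by
  rcases x with ⟨q, hq⟩ | ⟨⟨i, y, hy⟩⟩ | u
  · exact Or.inl ⟨q, ⟨hq, by rw [iQ_of hq]; exact hx⟩, (iQ_of hq).symm⟩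
  · exact Or.inr ⟨i, y, ⟨⟨hy.1, by rw [iB_ofB hy]; exact hx⟩, hy.2⟩, (iB_ofB hy).symm⟩
  · exact absurd hx he

lemma AmData.ssQ (D : AmData L A B Q b c) (R3 : L.Relations 3) (X : Set (AmG A B Q n))
    (h : iQ A B Q n '' Q ⊂ X) :
    letI := amStr R3 A B Q n b c
    delta L Q < delta L X := by
  classical
  let _ := amStr R3 A B Q n b c
  obtain ⟨I, J, hJI, hI, hJe, ht0, ht1, hYJ, hd, hcard⟩ := D.num R3 X
  have hQ := tQ_range_sub h.1
  have hJc := Finset.card_le_card hJI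
  have hTl := sum_ge_card I _ ht1
  change delta L Q < delta L X
  by_cases he : amE A B Q n ∈ X
  · simp only [if_pos he] at hd
    rw [hQ] at hd hTl
    omega
  · simp only [if_neg he, hJe he, Finset.card_empty] at hd
    have : I.Nonempty := by
      obtain ⟨x, hx, hx'⟩ := Set.exists_of_ssubset h
      rcases am_sub he hx with ⟨q, hq, rfl⟩ | ⟨i, y, hy, rfl⟩
      · exact absurd ⟨q, hq.1, rfl⟩ hx'
      · exact ⟨i, (hI i).2 fun h => hy.2 (h hy.1)⟩
    have := this.card_pos
    rw [hQ] at hd hTl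
    push_cast at hd
    omega

lemma AmData.ssB (D : AmData L A B Q b c) (R3 : L.Relations 3) (i : Fin n)
    (X : Set (AmG A B Q n)) (h : iB A B Q n i '' B ⊂ X) :
    letI := amStr R3 A B Q n b c
    delta L B < delta L X := by
  classical
  let _ := amStr R3 A B Q n b c
  obtain ⟨I, J, hJI, hI, hJe, ht0, ht1, hYJ, hd, hcard⟩ := D.num R3 X
  have hB := tB_range_sub h.1
  have hYf : (tQ X).Finite := D.hQ.subset fun x hx => hx.1
  have hi : i ∈ I := by
    rw [hI, hB]
    exact fun h => D.hbA i (h (D.hb i))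
  have hTm := sum_ge_one I _ ht1 hi
  rw [hB] at hTm
  have hl : 1 ≤ I.card := Finset.card_pos.2 ⟨i, hi⟩
  change delta L B < delta L X
  by_cases he : amE A B Q n ∈ X
  · simp only [if_pos he] at hd
    omega
  · simp only [if_neg he, hJe he, Finset.card_empty] at hd
    push_cast at hd
    obtain ⟨x, hx, hx'⟩ := Set.exists_of_ssubset h
    have h1 := ss_le D.sA hYf
    by_cases hYA : tQ X ⊆ A
    · have : 2 ≤ I.card := by
        rcases am_sub he hx with ⟨q, hq, rfl⟩ | ⟨j, y, hy, rfl⟩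
        · refine absurd ⟨q, D.hAB (hYA hq), ?_⟩ hx'
          exact iB_ofA (hYA hq)
        · have hj : j ∈ I := (hI j).2 fun h => hy.2 (h hy.1)
          have hij : i ≠ j := by
            rintro rfl
            exact hx' ⟨y, hy.1.1, rfl⟩
          exact Finset.one_lt_card.2 ⟨i, hi, j, hj, hij⟩
      omega
    · have := ss_lt D.sA hYf hYA
      omega

end Amalgam2
section Amalgam3

variable {L}
variable [L.IsRelational] [Finite (Σ n, L.Relations n)]
variable {N : Type} [L.Structure N]
variable {A B Q : Set N} {n : ℕ} {b c : Fin n → N} {f g : ℝ → ℝ}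

lemma am_relQ (R3 : L.Relations 3) (hAQ : A ⊆ Q) {k : ℕ} (r : L.Relations k) (s : Fin k → N)
    (hs : ∀ j, s j ∈ Q) :
    (amStr R3 A B Q n b c).RelMap r (iQ A B Q n ∘ s) ↔ Language.Structure.RelMap r s := by
  constructor
  · rintro (⟨s', hs', he, hr⟩ | ⟨i, s', hs', he, hr⟩ | ⟨i, he⟩)
    · have : s = s' := funext fun j => iQ_inj (hs j) (hs' j) (congrFun he j)
      rw [this]; exact hr
    · have : s = s' := funext fun j => iQB hAQ (hs j) (hs' j) (congrFun he j)
      rw [this]; exact hr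
    · exfalso
      obtain ⟨rfl, h2⟩ := Sigma.mk.inj he
      have h3 := congrFun (Prod.mk.inj (eq_of_heq h2)).2 2
      exact iQ_ne (hs 2) h3
  · intro hr
    exact Or.inl ⟨s, hs, rfl, hr⟩

lemma am_relB (R3 : L.Relations 3) (hAQ : A ⊆ Q) (i : Fin n) {k : ℕ} (r : L.Relations k)
    (s : Fin k → N) (hs : ∀ j, s j ∈ B) :
    (amStr R3 A B Q n b c).RelMap r (iB A B Q n i ∘ s) ↔ Language.Structure.RelMap r s := by
  constructor
  · rintro (⟨s', hs', he, hr⟩ | ⟨i', s', hs', he, hr⟩ | ⟨i', he⟩)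
    · have : s' = s := funext fun j => iQB hAQ (hs' j) (hs j) (congrFun he j).symm
      rw [← this]; exact hr
    · have : s = s' := funext fun j => iBB hAQ (hs j) (hs' j) (congrFun he j)
      rw [this]; exact hr
    · exfalso
      obtain ⟨rfl, h2⟩ := Sigma.mk.inj he
      have h3 := congrFun (Prod.mk.inj (eq_of_heq h2)).2 2
      exact iB_ne hAQ (hs 2) h3
  · intro hr
    exact Or.inr (Or.inl ⟨i, s, hs, rfl, hr⟩)

/-- embedding of `Q` -/
noncomputable def amQ (R3 : L.Relations 3) (hAQ : A ⊆ Q) (b c : Fin n → N) :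
    letI := amStr R3 A B Q n b c
    ↥(relSub L Q) ↪[L] AmG A B Q n :=
  letI := amStr R3 A B Q n b c
  { toFun := fun x => iQ A B Q n x.1
    inj' := fun x y h => Subtype.ext (iQ_inj x.2 y.2 h)
    map_fun' := fun f _ => isEmptyElim f
    map_rel' := fun r s => am_relQ R3 hAQ r (fun j => (s j).1) fun j => (s j).2 }

/-- embedding of `B` -/
noncomputable def amB (R3 : L.Relations 3) (hAQ : A ⊆ Q) (b c : Fin n → N) (i : Fin n) :
    letI := amStr R3 A B Q n b c
    ↥(relSub L B) ↪[L] AmG A B Q n :=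
  letI := amStr R3 A B Q n b c
  { toFun := fun x => iB A B Q n i x.1
    inj' := fun x y h => Subtype.ext (iBB hAQ x.2 y.2 h)
    map_fun' := fun f _ => isEmptyElim f
    map_rel' := fun r s => am_relB R3 hAQ i r (fun j => (s j).1) fun j => (s j).2 }

lemma delta_range {C : Set N} {M' : Type*} [L.Structure M'] (h : ↥(relSub L C) ↪[L] M') :
    delta L (Set.range h) = delta L C := by
  have h1 := delta_image h Set.univ
  have h2 := delta_image (relSub L C).subtype Set.univ
  rw [Set.image_univ] at h1 h2
  rw [h1, ← h2]
  congr 1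
  exact Subtype.range_coe

lemma AmData.exists (D : AmData L A B Q b c) (R3 : L.Relations 3) (hf : IsGoodFun f g)
    (hgen : IsGeneric L (N := N) f) (sQ : SelfSuffM L Q) :
    ∃ (e : N) (b' : Fin n → N), e ∉ Q ∧ ∀ i, Language.Structure.RelMap R3 ![b' i, c i, e] ∧
      ∃ h : ↥(relSub L B) ↪[L] N, SelfSuffM L (Set.range h) ∧
        (∀ x : ↥(relSub L B), (x : N) ∈ A → h x = x) ∧ h ⟨b i, D.hb i⟩ = b' i := by
  classical
  let _ := amStr R3 A B Q n b c
  have : Fintype ↥Q := D.hQ.fintype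
  have : Fintype ↥(B \ A) := (D.hB.subset Set.sdiff_subset).fintype
  have hr : Set.range (amQ (L := L) R3 D.hAQ b c : ↥(relSub L Q) → AmG A B Q n) =
      iQ A B Q n '' Q := by
    ext x
    constructor
    · rintro ⟨y, rfl⟩; exact ⟨y.1, y.2, rfl⟩
    · rintro ⟨y, hy, rfl⟩; exact ⟨⟨y, hy⟩, rfl⟩
  obtain ⟨h, h1, h2⟩ := hgen.2 Q D.hQ sQ (AmG A B Q n) inferInstance _ (D.inK R3 hf hgen)
    (amQ R3 D.hAQ b c) (by
      refine ⟨Set.subset_univ _, fun X hX _ _ => ?_⟩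
      rw [delta_range]
      rw [hr] at hX
      exact D.ssQ R3 X hX)
  have hQx : ∀ x ∈ Q, h (iQ A B Q n x) = x := fun x hx => h1 ⟨x, hx⟩
  refine ⟨h (amE A B Q n), fun i => h (iB A B Q n i (b i)), ?_, fun i => ⟨?_, ?_⟩⟩
  · intro he
    have := hQx _ he
    exact iQ_ne he (h.injective this)
  · have h3 : Language.Structure.RelMap R3
        ![iB A B Q n i (b i), iQ A B Q n (c i), amE A B Q n] := Or.inr (Or.inr ⟨i, rfl⟩)
    rw [← h.map_rel] at h3
    convert h3 using 1
    funext j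
    fin_cases j
    · rfl
    · exact (hQx _ (D.hc i)).symm
    · rfl
  · refine ⟨h.comp (amB R3 D.hAQ b c i), ?_, ?_, rfl⟩
    · have hrB : Set.range (amB (L := L) R3 D.hAQ b c i : ↥(relSub L B) → AmG A B Q n) =
          iB A B Q n i '' B := by
        ext x
        constructor
        · rintro ⟨y, rfl⟩; exact ⟨y.1, y.2, rfl⟩
        · rintro ⟨y, hy, rfl⟩; exact ⟨⟨y, hy⟩, rfl⟩
      have hc : Set.range (h.comp (amB (L := L) R3 D.hAQ b c i)) =
          h '' Set.range (amB (L := L) R3 D.hAQ b c i) := by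
        rw [← Set.range_comp]; rfl
      rw [hc]
      refine ss_image h h2 fun Y hY => ?_
      rw [delta_range]
      rw [hrB] at hY
      exact D.ssB R3 i Y hY
    · intro x hx
      change h (iB A B Q n i x) = x
      rw [iB_ofA hx]
      exact hQx _ (D.hAQ hx)

lemma gen_infinite (R3 : L.Relations 3) (hf : IsGoodFun f g)
    (hgen : IsGeneric L (N := N) f) : Infinite N := by
  by_contra hinf
  rw [not_infinite_iff_finite] at hinf
  have su : SelfSuffM L (Set.univ : Set N) := by
    refine ss_of_fin (Set.toFinite _) fun B _ h => ?_
    exact absurd (Set.subset_univ B) h.2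
  have D : AmData L (Set.univ : Set N) Set.univ Set.univ (Fin.elim0 : Fin 0 → N) Fin.elim0 :=
    ⟨Set.toFinite _, Set.toFinite _, Set.toFinite _, subset_rfl, subset_rfl, su,
      fun i => i.elim0, fun i => i.elim0, fun i => i.elim0, fun U _ hU _ => by
        rw [Set.univ_subset_iff.1 hU]; simp⟩
  obtain ⟨e, -, he, -⟩ := D.exists R3 hf hgen su
  exact he (Set.mem_univ e)

end Amalgam3
section Conclusion

variable {L}
variable [L.IsRelational] [Finite (Σ n, L.Relations n)]
variable {N : Type} [L.Structure N] {f g : ℝ → ℝ}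

lemma dM_insert_mem (hgen : IsGeneric L (N := N) f) {X : Set N} (hX : X.Finite) {c : N}
    (hc : c ∈ clM L X) : dM L (insert c X) = dM L X := by
  have : clM L (insert c X) = clM L X := by
    apply Set.Subset.antisymm
    · exact cl_min (Set.insert_subset hc (subset_cl X)) (cl_ss hgen hX)
    · exact cl_min ((Set.subset_insert c X).trans (subset_cl _)) (cl_ss hgen (hX.insert c))
  unfold dM
  rw [this]

lemma dM_insert_not_mem (hgen : IsGeneric L (N := N) f) {X : Set N} (hX : X.Finite) {c : N}
    (hc : c ∉ clM L X) : dM L (insert c X) = dM L X + 1 := by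
  have hf1 := cl_fin hgen hX
  have hf2 := cl_fin hgen (hX.insert c)
  apply le_antisymm
  · have h1 := dM_le hgen (hf1.insert c) (Set.insert_subset_insert (subset_cl (L := L) X) :
      insert c X ⊆ insert c (clM L X))
    have h2 := delta_union_le (L := L) hf1 (hf1.insert c) (Set.subset_insert c _)
    have h3 : (insert c (clM L X) \ clM L X).ncard ≤ 1 := by
      have : insert c (clM L X) \ clM L X ⊆ {c} := by
        rintro x ⟨hx | hx, hx'⟩
        · exact hx
        · exact absurd hx hx'
      simpa using Set.ncard_le_ncard this (Set.finite_singleton c)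
    unfold dM at *
    omega
  · have h1 : clM L X ⊂ clM L (insert c X) := by
      refine ⟨cl_min ((Set.subset_insert c X).trans (subset_cl _)) (cl_ss hgen (hX.insert c)), ?_⟩
      exact fun h => hc (h (subset_cl _ (Set.mem_insert c X)))
    exact ss_lt_sup (cl_ss hgen hX) hf2 h1

lemma loc_finite (hgen : IsGeneric L (N := N) f) (hFT : FT L N) {κ β : Type} [Finite κ] [Finite β]
    (a : κ → N) (c : β → N) (h : ∀ j, c j ∈ clM L (Set.range a)) : (Loc L a c).Finite := by
  have hfin := cl_fin hgen (Set.finite_range a)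
  have hss := cl_ss hgen (Set.finite_range a)
  set C := clM L (Set.range a) with hC
  refine (Set.Finite.pi' (fun _ : β => hfin)).subset ?_
  intro y hy j
  have hCf : Finite ↥(relSub L C) := hfin
  let s : β ⊕ κ → ↥(relSub L C) :=
    Sum.elim (fun j => ⟨c j, h j⟩) (fun i => ⟨a i, subset_cl _ ⟨i, rfl⟩⟩)
  have hs : (Subtype.val : ↥(relSub L C) → N) ∘ s = Sum.elim c a := by
    ext i; rcases i with i | i <;> rfl
  have hy : ST L (Sum.elim y a) (Sum.elim c a) := hy
  rw [← hs] at hy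
  obtain ⟨w, hw, hws⟩ := ST.hom hFT s hy
  let wE : ↥(relSub L C) ↪[L] N :=
    { toFun := w
      inj' := by
        intro p q hpq
        have := (hw ((Language.Term.var p).equal (Language.Term.var q))).1
          (by simpa [Language.Formula.realize_equal] using hpq)
        simp only [Language.Formula.realize_equal, Language.Term.realize_var] at this
        exact Subtype.ext this
      map_fun' := fun f _ => isEmptyElim f
      map_rel' := by
        intro n r t
        have := hw (r.formula fun i => Language.Term.var (t i))
        simp only [Language.Formula.realize_rel, Language.Term.realize_var] at this
        exact this }
  have hd : delta L (Set.range w) = delta L C := delta_range wE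
  have hWf : (Set.range w).Finite := Set.finite_range w
  have ha : Set.range a ⊆ C ∩ Set.range w := by
    rintro _ ⟨i, rfl⟩
    exact ⟨subset_cl _ ⟨i, rfl⟩, s (Sum.inr i), congrFun hws (Sum.inr i)⟩
  have h1 : delta L C ≤ delta L (C ∩ Set.range w) :=
    dM_le hgen (hfin.subset Set.inter_subset_left) ha
  have h2 : Set.range w ⊆ C := by
    by_contra hn
    have := ss_lt hss hWf hn
    omega
  have h3 : w (s (Sum.inl j)) = y j := congrFun hws (Sum.inl j)
  rw [← h3]
  exact h2 ⟨_, rfl⟩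

lemma dim_zero (hgen : IsGeneric L (N := N) f) (hFT : FT L N) (msd : MSMeasuring L N)
    {κ β : Type} [Fintype κ] [Fintype β]
    (a : κ → N) (c : β → N) (h : ∀ j, c j ∈ clM L (Set.range a)) : msd.dim (Loc L a c) = 0 :=
  (msd.finite_case _ (Loc_def hFT a c) ⟨c, mem_Loc a c⟩ (loc_finite hgen hFT a c h)).1

lemma dim_snoc (hFT : FT L N) (msd : MSMeasuring L N) {κ : Type} [Fintype κ] (a : κ → N) {n : ℕ}
    (b : Fin (n + 1) → N) : msd.dim (Loc L a b) =
      msd.dim (Loc L (Sum.elim (b ∘ Fin.castSucc) a) (fun _ : Fin 1 => b (Fin.last n))) +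
      msd.dim (Loc L a (b ∘ Fin.castSucc)) :=
  dim_add hFT msd a b Fin.castSucc (fun _ : Fin 1 => Fin.last n) fun i => by
    refine Fin.lastCases ?_ (fun j => ?_) i
    · exact Or.inr ⟨0, rfl⟩
    · exact Or.inl ⟨j, rfl⟩

lemma range_snoc {n : ℕ} (b : Fin (n + 1) → N) :
    Set.range b = insert (b (Fin.last n)) (Set.range (b ∘ Fin.castSucc)) := by
  ext x
  constructor
  · rintro ⟨i, rfl⟩
    refine Fin.lastCases ?_ (fun j => ?_) i
    · exact Or.inl rfl
    · exact Or.inr ⟨j, rfl⟩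
  · rintro (rfl | ⟨j, rfl⟩)
    · exact ⟨_, rfl⟩
    · exact ⟨_, rfl⟩

lemma full_tuple (hgen : IsGeneric L (N := N) f) (hFT : FT L N) (msd : MSMeasuring L N)
    [Infinite N] {κ : Type} [Fintype κ] (a : κ → N) (n : ℕ) : ∃ c : Fin n → N,
      msd.dim (Loc L a c) = n * msd.dim (Set.univ : Set (Fin 1 → N)) ∧
      dM L (Set.range a ∪ Set.range c) = dM L (Set.range a) + n := by
  induction n with
  | zero =>
    refine ⟨Fin.elim0, ?_, ?_⟩
    · rw [dim_zero hgen hFT msd a _ fun j => j.elim0]; simp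
    · simp
  | succ n ih =>
    obtain ⟨c, h1, h2⟩ := ih
    obtain ⟨c1, hc1⟩ := exists_full hFT msd (Sum.elim c a)
    let b : Fin (n + 1) → N := Fin.snoc (α := fun _ => N) c (c1 0)
    have e1 : b ∘ Fin.castSucc = c := by ext i; simp [b]
    have e2 : b (Fin.last n) = c1 0 := by simp [b]
    have e3 : (fun _ : Fin 1 => c1 0) = c1 := by ext i; rw [Subsingleton.elim i 0]
    have hr : Set.range (Sum.elim c a) = Set.range a ∪ Set.range c := by
      rw [Set.Sum.elim_range, Set.union_comm]
    have hnot : c1 0 ∉ clM L (Set.range a ∪ Set.range c) := by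
      intro hin
      have := dim_zero hgen hFT msd (Sum.elim c a) c1 (fun j => by
        rw [Subsingleton.elim j 0, hr]; exact hin)
      have := dim_univ_pos msd
      omega
    refine ⟨b, ?_, ?_⟩
    · rw [dim_snoc hFT msd a b, e1, e2, e3, hc1, h1]; ring
    · rw [range_snoc, e1, e2, Set.union_insert, dM_insert_not_mem hgen
        ((Set.finite_range a).union (Set.finite_range c)) hnot, h2]
      push_cast; ring

lemma dim_tuple_le (hFT : FT L N) (msd : MSMeasuring L N) {κ : Type} [Fintype κ] (a : κ → N)
    (b0 : N) (n : ℕ) (b : Fin (n + 1) → N)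
    (hb : ∀ i, (fun _ : Fin 1 => b i) ∈ Loc L a (fun _ : Fin 1 => b0)) :
    msd.dim (Loc L a b) ≤ (n + 1) * msd.dim (Loc L a (fun _ : Fin 1 => b0)) := by
  have hs : ∀ {κ' : Type} [Fintype κ'] (u : κ' → N) (i : Fin (n + 1)),
      msd.dim (Loc L (Sum.elim u a) (fun _ : Fin 1 => b i)) ≤
      msd.dim (Loc L a (fun _ : Fin 1 => b0)) := by
    intro κ' _ u i
    rw [← Loc_eq (hb i)]
    exact dim_sub hFT msd (Sum.elim u a) (fun _ : Fin 1 => b i) Sum.inr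
  have : ∀ k (hk : k ≤ n), msd.dim (Loc L a (fun i : Fin (k + 1) => b (Fin.castLE (by omega) i))) ≤
      (k + 1) * msd.dim (Loc L a (fun _ : Fin 1 => b0)) := by
    intro k
    induction k with
    | zero =>
      intro hk
      have e : (fun i : Fin (0 + 1) => b (Fin.castLE (by omega) i)) = fun _ : Fin 1 => b 0 := by
        ext i
        have : i = 0 := Fin.ext (by omega)
        subst this; rfl
      rw [e, Loc_eq (hb 0)]; simp
    | succ k ih =>
      intro hk
      rw [dim_snoc hFT msd]
      have h1 := ih (by omega)
      have h2 := hs ((fun i : Fin (k + 1 + 1) => b (Fin.castLE (by omega) i)) ∘ Fin.castSucc)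
        (Fin.castLE (by omega) (Fin.last (k + 1)))
      have h3 : (fun i : Fin (k + 1 + 1) => b (Fin.castLE (by omega) i)) ∘ Fin.castSucc =
        fun i : Fin (k + 1) => b (Fin.castLE (by omega) i) := by ext i; rfl
      rw [h3] at h2 ⊢
      have : (k + 1 + 1) * msd.dim (Loc L a (fun _ : Fin 1 => b0)) =
        msd.dim (Loc L a (fun _ : Fin 1 => b0)) +
          (k + 1) * msd.dim (Loc L a (fun _ : Fin 1 => b0)) := by ring
      rw [this]
      exact add_le_add h2 h1
  exact this n le_rfl

lemma core (R3 : L.Relations 3) (hf : IsGoodFun f g) (hgen : IsGeneric L (N := N) f)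
    (hFT : FT L N) (msd : MSMeasuring L N) [Infinite N] {κ : Type} [Fintype κ] (a : κ → N)
    (b0 : N) (hb0 : b0 ∉ clM L (Set.range a)) :
    msd.dim (Loc L a (fun _ : Fin 1 => b0)) = msd.dim (Set.univ : Set (Fin 1 → N)) := by
  set D := msd.dim (Set.univ : Set (Fin 1 → N)) with hD
  set x := msd.dim (Loc L a (fun _ : Fin 1 => b0)) with hx
  have hup : ∀ {κ' : Type} [Fintype κ'] (u : κ' → N) (v : Fin 1 → N),
      msd.dim (Loc L u v) ≤ D := fun u v =>
    dim_mono msd ⟨v, mem_Loc u v⟩ (Loc_def hFT u v) Set.definable_univ (Set.subset_univ _)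
  have hxD : x ≤ D := hup a _
  by_contra hne
  have hlt : x < D := lt_of_le_of_ne hxD hne
  obtain ⟨c, hc1, hc2⟩ := full_tuple hgen hFT msd a (D + 1)
  have fa := Set.finite_range a
  have fb : (insert b0 (Set.range a)).Finite := fa.insert b0
  have fc : (Set.range a ∪ Set.range c).Finite := fa.union (Set.finite_range c)
  have Dt : AmData L (clM L (Set.range a)) (clM L (insert b0 (Set.range a)))
      (clM L (Set.range a ∪ Set.range c)) (fun _ : Fin (D + 1) => b0) c :=
    { hA := cl_fin hgen fa
      hB := cl_fin hgen fb
      hQ := cl_fin hgen fc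
      hAB := cl_min ((Set.subset_insert _ _).trans (subset_cl _)) (cl_ss hgen fb)
      hAQ := cl_min (Set.subset_union_left.trans (subset_cl _)) (cl_ss hgen fc)
      sA := cl_ss hgen fa
      hb := fun _ => subset_cl _ (Set.mem_insert _ _)
      hbA := fun _ => hb0
      hc := fun i => subset_cl _ (Or.inr ⟨i, rfl⟩)
      hind := by
        intro U hU h1 h2
        have := dM_le hgen hU (Set.union_subset ((subset_cl (L := L) _).trans h1) h2)
        rw [hc2] at this
        exact this }
  obtain ⟨e, b', -, hb'⟩ := Dt.exists R3 hf hgen (cl_ss hgen fc)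
  have hloc : ∀ i, (fun _ : Fin 1 => b' i) ∈ Loc L a (fun _ : Fin 1 => b0) := by
    intro i
    obtain ⟨-, h, hs, hA, hbi⟩ := hb' i
    have bf := BF.of_emb Dt.hB (cl_ss hgen fb) h hs
    let s : Fin 1 ⊕ κ → ↥(relSub L (clM L (insert b0 (Set.range a)))) :=
      Sum.elim (fun _ => ⟨b0, Dt.hb i⟩) (fun j => ⟨a j, subset_cl _ (Or.inr ⟨j, rfl⟩)⟩)
    have st := BF.st hgen bf s
    have e1 : Subtype.val ∘ s = Sum.elim (fun _ : Fin 1 => b0) a := by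
      ext j; rcases j with j | j <;> rfl
    have e2 : h ∘ s = Sum.elim (fun _ : Fin 1 => b' i) a := by
      ext j; rcases j with j | j
      · exact hbi
      · exact hA (s (Sum.inr j)) (subset_cl _ ⟨j, rfl⟩)
    rw [e1, e2] at st
    exact st.symm
  let w : Fin (D + 1) ⊕ Fin 1 → N := Sum.elim b' (fun _ => e)
  let v : (Fin (D + 1) ⊕ Fin 1) ⊕ Fin (D + 1) → N := Sum.elim w c
  have d1 := dim_add hFT msd a v Sum.inl Sum.inr (fun i => by
    rcases i with i | i
    · exact Or.inl ⟨i, rfl⟩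
    · exact Or.inr ⟨i, rfl⟩)
  have d2 := dim_add hFT msd a v Sum.inr Sum.inl (fun i => by
    rcases i with i | i
    · exact Or.inr ⟨i, rfl⟩
    · exact Or.inl ⟨i, rfl⟩)
  have d3 := dim_add hFT msd a w Sum.inl Sum.inr (fun i => by
    rcases i with i | i
    · exact Or.inl ⟨i, rfl⟩
    · exact Or.inr ⟨i, rfl⟩)
  have v1 : v ∘ Sum.inl = w := rfl
  have v2 : v ∘ Sum.inr = c := rfl
  have w1 : w ∘ Sum.inl = b' := rfl
  rw [v1, v2] at d1 d2
  rw [w1] at d3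
  have z1 : msd.dim (Loc L (Sum.elim w a) c) = 0 := by
    refine dim_zero hgen hFT msd _ c fun i => ?_
    have fr := Set.finite_range (Sum.elim w a)
    exact rel_mem (cl_fin hgen fr) (cl_ss hgen fr) R3 (hb' i).1
      (subset_cl _ ⟨Sum.inl (Sum.inl i), rfl⟩) (subset_cl _ ⟨Sum.inl (Sum.inr 0), rfl⟩)
  have z2 := hup (Sum.elim b' a) (w ∘ Sum.inr)
  have z3 := dim_tuple_le hFT msd a b0 D b' hloc
  rw [← hx] at z3
  have z4 : (D + 1) * D ≤ D + (D + 1) * x := by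
    have hc3 : msd.dim (Loc L a c) = (D + 1) * D := hc1
    linarith
  have z5 : (D + 1) * (x + 1) ≤ (D + 1) * D := Nat.mul_le_mul_left _ hlt
  have : (D + 1) * (x + 1) = (D + 1) * x + D + 1 := by ring
  omega

lemma single_step (R3 : L.Relations 3) (hf : IsGoodFun f g) (hgen : IsGeneric L (N := N) f)
    (hFT : FT L N) (msd : MSMeasuring L N) [Infinite N] {κ : Type} [Fintype κ] (a : κ → N)
    (c : N) : (msd.dim (Loc L a (fun _ : Fin 1 => c)) : ℤ) =
      msd.dim (Set.univ : Set (Fin 1 → N)) *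
        (dM L (insert c (Set.range a)) - dM L (Set.range a)) := by
  by_cases hc : c ∈ clM L (Set.range a)
  · rw [dM_insert_mem hgen (Set.finite_range a) hc, dim_zero hgen hFT msd a _ fun _ => hc]
    simp
  · rw [dM_insert_not_mem hgen (Set.finite_range a) hc, core R3 hf hgen hFT msd a c hc]
    ring

lemma all_steps (R3 : L.Relations 3) (hf : IsGoodFun f g) (hgen : IsGeneric L (N := N) f)
    (hFT : FT L N) (msd : MSMeasuring L N) [Infinite N] {κ : Type} [Fintype κ] (a : κ → N)
    (m : ℕ) (b : Fin m → N) : (msd.dim (Loc L a b) : ℤ) =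
      msd.dim (Set.univ : Set (Fin 1 → N)) *
        (dM L (Set.range a ∪ Set.range b) - dM L (Set.range a)) := by
  induction m with
  | zero =>
    rw [dim_zero hgen hFT msd a b fun j => j.elim0]
    simp [Set.range_eq_empty]
  | succ m ih =>
    rw [dim_snoc hFT msd a b]
    push_cast
    rw [single_step R3 hf hgen hFT msd, ih, range_snoc b, Set.Sum.elim_range, Set.union_insert,
      Set.union_comm (Set.range a)]
    ring

end Conclusion
/-- **Theorem 4.4**: if `f` is good with right derivative `≤ 1/(2(x+1))` and the generic
structure `M_f` is MS-measurable with dimension-measure function `(dim, μ)`, then for all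
finite tuples `ā`, `b̄` in `M_f`: `dim(loc(b̄/ā)) = dim(M_f)·d(b̄/ā)`. -/
theorem dim_eq_scaled_d
    (L : FirstOrder.Language) [L.IsRelational]
    [Finite (Σ n, L.Relations n)] (R3 : L.Relations 3)
    (f g : ℝ → ℝ) (hf : IsGoodFun f g)
    (hg : ∀ x ∈ Set.Ici (0 : ℝ), g x ≤ 1 / (2 * (x + 1)))
    (N : Type) [L.Structure N] [Countable N]
    (hgen : IsGeneric L (N := N) f)
    (msd : MSMeasuring L N) :
    ∀ (k m : ℕ) (a : Fin k → N) (b : Fin m → N),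
      (msd.dim (locus L a b) : ℤ) =
        (msd.dim (Set.univ : Set (Fin 1 → N)) : ℤ) *
          (dM L (Set.range a ∪ Set.range b) - dM L (Set.range a)) := by
  have hinf : Infinite N := gen_infinite R3 hf hgen
  have hFT : FT L N := fun ι _ => fin_types hgen hf.unbounded ι
  intro k m a b
  rw [locus_eq]
  exact all_steps R3 hf hgen hFT msd a m b

end MeasureAmalgamation
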